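/- Suppose T is a standard shifted tableau with n boxes, □_j denotes the unique box of T containing j or j', and i ∈ [n−1]. Then: (a) the operator 𝔡_i is an involution which only changes the values of T in the boxes □_i, □_{i+1}, and □_{i+2}; (b) if □_i and □_{i+2} are not both on the main diagonal, then #primes(T) = #primes(𝔡_i(T)) and the main-diagonal positions with primed entries in 𝔡_i(T) are the same as those in T; (c) if □_i and □_{i+2} are both on the main diagonal, then #primes(T) = #primes(𝔡_i(T)) ± 1. -/

import Mathlib

/-! ## Primed letters: the alphabet `ℤ ⊔ ℤ'`, with `i' = i - 1/2`.
A letter is encoded by its "ceiling" together with a flag recording whether it is primed. -/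

structure Letter where
  ceil : ℤ
  primed : Bool
deriving DecidableEq, Repr

instance : Inhabited Letter := ⟨⟨0, false⟩⟩

/-- The order `⋯ < 1' < 1 < 2' < 2 < ⋯`. -/
instance : LinearOrder Letter :=
  LinearOrder.lift' (fun x : Letter => toLex (x.ceil, !x.primed))
    (fun a b h => by
      have h' : (a.ceil, !a.primed) = (b.ceil, !b.primed) := toLex.injective h
      obtain ⟨ac, ap⟩ := a
      obtain ⟨bc, bp⟩ := b
      simp only [Prod.mk.injEq] at h'
      obtain ⟨h1, h2⟩ := h'
      cases ap <;> cases bp <;> simp_all)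

/-- A primed word. -/
abbrev PWord := List Letter

def Letter.unprime (x : Letter) : Letter := ⟨x.ceil, false⟩

def Letter.succL (x : Letter) : Letter := ⟨x.ceil + 1, x.primed⟩

/-- `unprime` of a primed word: replace each letter `x` by `⌈x⌉`. -/
def unprimeWord (a : PWord) : List ℤ := a.map Letter.ceil

/-- `unprime` of a primed word, as a primed word with no primes. -/
def unprimeP (a : PWord) : PWord := a.map Letter.unprime

/-! ## Involution words -/

/-- The simple transposition `s_i = (i, i+1)` of `ℤ`. -/
def sPerm (i : ℤ) : Equiv.Perm ℤ := Equiv.swap i (i + 1)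

/-- The Demazure product `s_{w_1} ∘ s_{w_2} ∘ ⋯ ∘ s_{w_k}` of a word, computed by the
defining recursion `σ ∘ s_i = σ·s_i` if `σ(i) < σ(i+1)` and `σ ∘ s_i = σ` otherwise. -/
def heckeProd (w : List ℤ) : Equiv.Perm ℤ :=
  w.foldl (fun σ i => if σ i < σ (i + 1) then σ * sPerm i else σ) 1

/-- `s_{a_n} ∘ ⋯ ∘ s_{a_2} ∘ s_{a_1} ∘ s_{a_2} ∘ ⋯ ∘ s_{a_n}` for `a = a_1 a_2 ⋯ a_n`. -/
def invHecke (a : List ℤ) : Equiv.Perm ℤ := heckeProd (a.reverse ++ a.tail)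

/-- Membership in `I_ℤ`: a finitely supported involution of `ℤ`. -/
def IZ (z : Equiv.Perm ℤ) : Prop := {x : ℤ | z x ≠ x}.Finite ∧ z * z = 1

/-- The set of involution words of `z`. -/
def Rinv (z : Equiv.Perm ℤ) : Set (List ℤ) :=
  {a | invHecke a = z ∧ ∀ b : List ℤ, invHecke b = z → a.length ≤ b.length}

/-- 0-based index `k` is a commutation in the word `a` (this corresponds to the 1-based
index `k+1`): `a_{k+1}` and `a_{k+1} + 1` are both fixed points of
`s_{a_k} ∘ ⋯ ∘ s_{a_1} ∘ ⋯ ∘ s_{a_k}`. -/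
def IsCommutation (a : List ℤ) (k : ℕ) : Prop :=
  ∃ x, a[k]? = some x ∧ invHecke (a.take k) x = x ∧ invHecke (a.take k) (x + 1) = x + 1

/-- The set of primed involution words of `z`. -/
def RinvPlus (z : Equiv.Perm ℤ) : Set PWord :=
  {a | unprimeWord a ∈ Rinv z ∧
     ∀ (k : ℕ) (x : Letter), a[k]? = some x → x.primed = true →
       IsCommutation (unprimeWord a) k}

/-! ## Shifted tableaux.
A shifted tableau is recorded as its list of rows, from the first (bottom) row upward;
the entry at 0-based index `k` of 0-based row `r` occupies the box in row `r+1` and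
column `r+1+k` of the shifted diagram. -/

abbrev STab := List (List Letter)

/-- A strict partition, recorded as its (strictly decreasing) list of positive parts. -/
def IsStrictPartition (sh : List ℕ) : Prop :=
  List.Chain' (fun a b => b < a) sh ∧ ∀ m ∈ sh, 0 < m

def shapeOf {α : Type*} (T : List (List α)) : List ℕ := T.map List.length

/-- The rows form the shifted diagram of a strict partition. -/
def IsShifted {α : Type*} (T : List (List α)) : Prop := IsStrictPartition (shapeOf T)

/-- The entry of `T` in (0-based) row `r` and column `c` of the shifted diagram. -/
def entryG? {α : Type*} (T : List (List α)) (r c : ℕ) : Option α :=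
  if r ≤ c then (T[r]?).bind (fun row => row[c - r]?) else none

def entry? (T : STab) (r c : ℕ) : Option Letter := entryG? T r c

def setRowG {α : Type*} (T : List (List α)) (r : ℕ) (row : List α) : List (List α) :=
  if r < T.length then T.set r row else T ++ [row]

def setEntryG {α : Type*} (T : List (List α)) (r c : ℕ) (x : α) : List (List α) :=
  T.set r ((T.getD r []).set (c - r) x)

def numCols {α : Type*} (T : List (List α)) : ℕ := (T.getD 0 []).length

/-- Row reading word: rows left to right, starting with the last (top) row. -/
def rowWord (T : STab) : PWord := T.reverse.flatten

/-- Column reading word: columns top to bottom, starting with the first column. -/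
def colWord (T : STab) : PWord :=
  (List.range (numCols T)).flatMap (fun c =>
    ((List.range (c + 1)).reverse).filterMap (fun r => entry? T r c))

def unprimeT (T : STab) : STab := T.map (List.map Letter.unprime)

/-- Remove the primes from all main-diagonal entries. -/
def unprimeDiagT (T : STab) : STab :=
  T.map (fun row =>
    match row with
    | [] => []
    | x :: rest => Letter.unprime x :: rest)

/-- Rows and columns are strictly increasing. -/
def IsIncreasing (T : STab) : Prop :=
  (∀ r c x y, entry? T r c = some x → entry? T r (c + 1) = some y → x < y) ∧
  (∀ r c x y, entry? T r c = some x → entry? T (r + 1) c = some y → x < y)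

/-- No primed entries on the main diagonal. -/
def NoDiagPrimes (T : STab) : Prop :=
  ∀ r x, entry? T r r = some x → x.primed = false

/-- Entries positive, rows and columns weakly increasing, no primed entry repeated
in a row and no unprimed entry repeated in a column. -/
def IsSemistandard (T : STab) : Prop :=
  (∀ x ∈ T.flatten, 0 < x.ceil) ∧
  (∀ r c x y, entry? T r c = some x → entry? T r (c + 1) = some y → x ≤ y) ∧
  (∀ r c x y, entry? T r c = some x → entry? T (r + 1) c = some y → x ≤ y) ∧
  (∀ r c c' x, c < c' → entry? T r c = some x → entry? T r c' = some x →
    x.primed = false) ∧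
  (∀ r r' c x, r < r' → entry? T r c = some x → entry? T r' c = some x →
    x.primed = true)

/-- Increasing, with exactly one of `i` or `i'` as an entry for each `i = 1, …, n`,
where `n` is the number of boxes. -/
def IsStandard (T : STab) : Prop :=
  IsIncreasing T ∧
  ∀ i : ℤ, 1 ≤ i → i ≤ (T.flatten.length : ℤ) →
    T.flatten.countP (fun x => decide (x.ceil = i)) = 1
/-! ## Orthogonal Edelman–Greene insertion -/

/-- "Switching the primes" of a pair: reverse the primes on both letters if exactly one
of them is unprimed, and leave them unchanged otherwise. -/
def switchPrimes (x y : Letter) : Letter × Letter :=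
  if x.primed = y.primed then (x, y)
  else (⟨x.ceil, !x.primed⟩, ⟨y.ceil, !y.primed⟩)

/-- Column-insertion stage of orthogonal Edelman–Greene insertion:
insert letter `w` into column `c` of `T` (then continue into later columns). -/
def egCol : ℕ → STab → ℕ → Letter → STab × Bool
  | 0, T, _, _ => (T, true)
  | fuel + 1, T, c, w =>
    let occ := (List.range (c + 1)).filterMap (fun r => (entry? T r c).map (fun x => (r, x)))
    match occ.findIdx? (fun p => decide (w.ceil < p.2.ceil)) with
    | none =>
        -- place `w` in the first empty box of the column
        let r := occ.length
        let w' := if r = c ∧ w.primed then Letter.unprime w else w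
        (setRowG T r ((T.getD r []) ++ [w']), if r = c then w.primed else true)
    | some kM =>
        let km := (occ.findIdx? (fun p => decide (w.ceil ≤ p.2.ceil))).getD kM
        let im := (occ.getD km (0, default)).1
        let m := (occ.getD km (0, default)).2
        if km = kM then
          if im = c then
            -- m = M on the main diagonal
            egCol fuel (setEntryG T im c (Letter.unprime w)) (c + 1) ⟨m.ceil, w.primed⟩
          else
            -- m = M off the main diagonal
            egCol fuel (setEntryG T im c w) (c + 1) m
        else
          -- m < M : switch the primes on m and M, insert w+1 into the next column
          let iM := (occ.getD kM (0, default)).1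
          let M := (occ.getD kM (0, default)).2
          let p := switchPrimes m M
          egCol fuel (setEntryG (setEntryG T im c p.1) iM c p.2) (c + 1) (Letter.succL w)

/-- Row-insertion stage of orthogonal Edelman–Greene insertion:
insert letter `w` into row `r` of `T`. -/
def egRow : ℕ → STab → ℕ → Letter → STab × Bool
  | 0, T, _, _ => (T, true)
  | fuel + 1, T, r, w =>
    let row := T.getD r []
    match row.findIdx? (fun x => decide (w.ceil < x.ceil)) with
    | none =>
        if row.isEmpty ∧ w.primed then (setRowG T r [Letter.unprime w], true)
        else (setRowG T r (row ++ [w]), false)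
    | some kM =>
        let km := (row.findIdx? (fun x => decide (w.ceil ≤ x.ceil))).getD kM
        let m := row.getD km default
        if km = kM then
          if km = 0 then
            -- m = M on the main diagonal
            egCol fuel (setRowG T r (row.set 0 (Letter.unprime w))) (r + 1)
              ⟨m.ceil, w.primed⟩
          else
            -- m = M off the main diagonal
            egRow fuel (setRowG T r (row.set km w)) (r + 1) m
        else
          -- m < M : switch primes; insert w+1 into the next column (if m is on the
          -- main diagonal) or the next row (otherwise)
          let M := row.getD kM default
          let p := switchPrimes m M
          let row' := (row.set km p.1).set kM p.2
          if km = 0 then egCol fuel (setRowG T r row') (r + 1) (Letter.succL w)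
          else egRow fuel (setRowG T r row') (r + 1) (Letter.succL w)

/-- `T ←ᴼ u` together with the flag recording whether the insertion ended in
column insertion. -/
def egInsert (T : STab) (u : Letter) : STab × Bool :=
  egRow (T.flatten.length + T.length + 2) T 0 u

/-- The orthogonal Edelman–Greene insertion tableau `P_EGᴼ(a)`. -/
def PEG (a : PWord) : STab := a.foldl (fun T u => (egInsert T u).1) []

/-- Add the recording letter `x` to `Q` in the unique box of `Pnew` not in `Pold`. -/
def addBox (Q Pold Pnew : STab) (x : Letter) : STab :=
  match (List.range Pnew.length).find?
      (fun r => decide ((Pold.getD r []).length ≠ (Pnew.getD r []).length)) with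
  | some r => setRowG Q r ((Q.getD r []) ++ [x])
  | none => Q

def QEGaux : STab → STab → ℕ → PWord → STab
  | _, Q, _, [] => Q
  | P, Q, n, u :: rest =>
      let res := egInsert P u
      QEGaux res.1 (addBox Q P res.1 ⟨(n : ℤ), res.2⟩) (n + 1) rest

/-- The orthogonal Edelman–Greene recording tableau `Q_EGᴼ(a)`. -/
def QEG (a : PWord) : STab := QEGaux [] [] 1 a

/-! ## Orthogonal Coxeter–Knuth operators -/

def ock1 (x : Letter) : Letter := ⟨x.ceil, !x.primed⟩

def ock2 (x y : Letter) : Letter × Letter := (⟨y.ceil, x.primed⟩, ⟨x.ceil, y.primed⟩)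

def ock3 (x y z : Letter) : Letter × Letter × Letter :=
  if x.ceil = z.ceil ∧ (x.ceil - y.ceil = 1 ∨ y.ceil - x.ceil = 1) then
    if x.primed = false ∧ y.primed = false ∧ z.primed = false then
      -- XYX ↔ YXY
      (⟨y.ceil, false⟩, ⟨x.ceil, false⟩, ⟨y.ceil, false⟩)
    else if x.primed = true ∧ y.primed = false ∧ z.primed = false then
      -- X'YX ↦ YXY'
      (⟨y.ceil, false⟩, ⟨x.ceil, false⟩, ⟨y.ceil, true⟩)
    else if x.primed = false ∧ y.primed = false ∧ z.primed = true then
      -- YXY' ↦ X'YX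
      (⟨y.ceil, true⟩, ⟨x.ceil, false⟩, ⟨y.ceil, false⟩)
    else (x, y, z)
  else if (x.ceil < z.ceil ∧ z.ceil < y.ceil) ∨ (y.ceil < z.ceil ∧ z.ceil < x.ceil) then
    -- ACB ↔ CAB
    (y, x, z)
  else if (y.ceil < x.ceil ∧ x.ceil < z.ceil) ∨ (z.ceil < x.ceil ∧ x.ceil < y.ceil) then
    -- BCA ↔ BAC
    (x, z, y)
  else (x, y, z)

/-- The operator `ock_i` for `i ∈ ℤ`. -/
def ockW (i : ℤ) (a : PWord) : PWord :=
  if i = -1 then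
    match a with
    | [] => []
    | x :: rest => ock1 x :: rest
  else if i = 0 then
    match a with
    | x :: y :: rest => (ock2 x y).1 :: (ock2 x y).2 :: rest
    | _ => a
  else if 1 ≤ i ∧ i + 2 ≤ (a.length : ℤ) then
    let k := (i - 1).toNat
    match a[k]?, a[k + 1]?, a[k + 2]? with
    | some x, some y, some z =>
        a.take k ++ [(ock3 x y z).1, (ock3 x y z).2.1, (ock3 x y z).2.2] ++ a.drop (k + 3)
    | _, _, _ => a
  else a

/-- Orthogonal Coxeter–Knuth equivalence: generated by `a ∼ ock_i(a)` for all `i ∈ ℤ`. -/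
def OckEquiv : PWord → PWord → Prop :=
  Relation.EqvGen (fun a b => ∃ i : ℤ, b = ockW i a)
/-! ## Descents -/

/-- Descent set of a primed word (as a set of 1-based positions). -/
def DesWord (a : PWord) : Set ℤ :=
  {i | ∃ k : ℕ, i = (k : ℤ) + 1 ∧ ∃ x y, a[k]? = some x ∧ a[k + 1]? = some y ∧ y < x}

/-- Descent set of a standard shifted tableau. -/
def DesT (T : STab) : Set ℤ :=
  {i | 0 < i ∧ (
    (∃ r c r' c', entry? T r c = some ⟨i, false⟩ ∧
        entry? T r' c' = some ⟨i + 1, false⟩ ∧ r < r') ∨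
    (∃ r c r' c', entry? T r c = some ⟨i, true⟩ ∧
        entry? T r' c' = some ⟨i + 1, true⟩ ∧ c < c') ∨
    (∃ r c r' c', entry? T r c = some ⟨i, false⟩ ∧
        entry? T r' c' = some ⟨i + 1, true⟩))}

/-! ## Dual equivalence operators on standard shifted tableaux -/

def numPrimes (T : STab) : ℕ := T.flatten.countP (fun x => x.primed)

/-- The entries of column `c`, read from bottom to top (increasing). -/
def colLetters (T : STab) (c : ℕ) : PWord :=
  (List.range (c + 1)).filterMap (fun r => entry? T r c)

/-- The shifted reading word `unprime(C_q R_q ⋯ C_1 R_1)`. -/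
def shword (T : STab) : List ℤ :=
  (((List.range (numCols T)).reverse).flatMap (fun idx =>
    (colLetters T idx).filter (fun x => x.primed) ++
      ((T.getD idx []).filter (fun x => !x.primed)))).map Letter.ceil

def idxOfZ (v : ℤ) : List ℤ → ℕ
  | [] => 0
  | x :: r => if x = v then 0 else idxOfZ v r + 1

def positionsOf (T : STab) : List (ℕ × ℕ) :=
  (List.range T.length).flatMap (fun r =>
    (List.range (T.getD r []).length).map (fun k => (r, r + k)))

/-- The box `□_v` of `T` containing `v` or `v'`. -/
def boxOf (T : STab) (v : ℤ) : Option (ℕ × ℕ) :=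
  (positionsOf T).find? (fun p =>
    match entry? T p.1 p.2 with
    | some x => decide (x.ceil = v)
    | none => false)

/-- Reverse the prime of the entry in position `(r, c)`. -/
def togglePos (T : STab) (r c : ℕ) : STab :=
  match entry? T r c with
  | some x => setEntryG T r c ⟨x.ceil, !x.primed⟩
  | none => T

/-- Switch the primes of the entries in the two given positions. -/
def switchAt (T : STab) (p q : ℕ × ℕ) : STab :=
  match entry? T p.1 p.2, entry? T q.1 q.2 with
  | some x, some y =>
      if x.primed = y.primed then T else togglePos (togglePos T p.1 p.2) q.1 q.2
  | _, _ => T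

/-- The row index of `□_v` if it is a main-diagonal box. -/
def diagBox? (T : STab) (v : ℤ) : Option ℕ :=
  (boxOf T v).bind (fun p => if p.1 = p.2 then some p.1 else none)

def switchDiag (T T' : STab) (u v : ℤ) : STab :=
  match diagBox? T u, diagBox? T v with
  | some r, some s => switchAt T' (r, r) (s, s)
  | _, _ => T'

/-- The operator `𝔰_i`. -/
def sOp (i : ℤ) (T : STab) : STab :=
  match boxOf T i, boxOf T (i + 1) with
  | some (r1, c1), some (r2, c2) =>
      if r1 ≠ r2 ∧ c1 ≠ c2 then
        -- swap i ↔ i+1 and i' ↔ (i+1)'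
        setEntryG (setEntryG T r1 c1 ⟨i + 1, ((entry? T r1 c1).getD default).primed⟩)
          r2 c2 ⟨i, ((entry? T r2 c2).getD default).primed⟩
      else if r1 ≠ c1 ∧ r2 ≠ c2 then
        -- same row or column, neither box diagonal: reverse both primes
        togglePos (togglePos T r1 c1) r2 c2
      else
        -- same row or column, one box diagonal
        let T1 := if r1 = c1 then togglePos T r2 c2 else togglePos T r1 c1
        let T2 :=
          if 1 ≤ i - 1 ∧ (diagBox? T (i - 1)).isSome ∧ (diagBox? T (i + 1)).isSome then
            switchDiag T T1 (i - 1) (i + 1)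
          else T1
        if i + 2 ≤ (T.flatten.length : ℤ) ∧ (diagBox? T i).isSome ∧
            (diagBox? T (i + 2)).isSome then
          switchDiag T T2 i (i + 2)
        else T2
  | _, _ => T

def btwn (a m b : ℕ) : Prop := (a < m ∧ m < b) ∨ (b < m ∧ m < a)

instance (a m b : ℕ) : Decidable (btwn a m b) := by unfold btwn; infer_instance

/-- The dual equivalence operator `𝔡_i` for `i ∈ ℤ`. -/
def dOp (i : ℤ) (T : STab) : STab :=
  if ¬(1 ≤ i + 2 ∧ i + 2 ≤ (T.flatten.length : ℤ)) then T
  else if i = -1 then togglePos T 0 0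
  else if i = 0 then togglePos T 0 1
  else
    let w := shword T
    if btwn (idxOfZ i w) (idxOfZ (i + 2) w) (idxOfZ (i + 1) w) then sOp i T
    else if btwn (idxOfZ (i + 1) w) (idxOfZ i w) (idxOfZ (i + 2) w) then sOp (i + 1) T
    else T

/-! ## Marked cycles -/

/-- The 2-cycles of `z`, as ordered pairs `(i, j)` with `i < j = z(i)`. -/
def cycSet (z : Equiv.Perm ℤ) : Set (ℤ × ℤ) := {p | p.1 < p.2 ∧ z p.1 = p.2}

/-- `s_{a_n} ⋯ s_{a_{k+2}} s_{a_{k+1}}` (ordinary product; 0-based index `k`). -/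
def suffixPerm (a : List ℤ) (k : ℕ) : Equiv.Perm ℤ :=
  ((a.drop (k + 1)).reverse.map sPerm).prod

/-- `γ_{k+1}(a)` as an ordered pair (junk value `(0,0)` off the commutation set). -/
def gammaPair (a : List ℤ) (k : ℕ) : ℤ × ℤ :=
  match a[k]? with
  | some x => (min (suffixPerm a k x) (suffixPerm a k (x + 1)),
               max (suffixPerm a k x) (suffixPerm a k (x + 1)))
  | none => (0, 0)
/-! ## Increasing factorization sequences and Schur Q-functions -/

/-- `Incr_∞(R_inv^+(z))`: sequences of weakly increasing primed words, all but
finitely many empty, whose concatenation is a primed involution word for `z`. -/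
def IncrSeq (z : Equiv.Perm ℤ) : Set (ℕ → PWord) :=
  {φ | (∀ n, List.Chain' (· ≤ ·) (φ n)) ∧
    ∃ N, (∀ n, N ≤ n → φ n = []) ∧ ((List.range N).map φ).flatten ∈ RinvPlus z}

/-- Least bound past which a sequence of words is empty. -/
noncomputable def seqBound (φ : ℕ → PWord) : ℕ := sInf {N | ∀ n, N ≤ n → φ n = []}

/-- The concatenation `a^1 a^2 ⋯` of a sequence of words. -/
noncomputable def concatSeq (φ : ℕ → PWord) : PWord :=
  ((List.range (seqBound φ)).map φ).flatten

/-- `ℓ(a^1) + ⋯ + ℓ(a^i)`. -/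
def prefLen (φ : ℕ → PWord) (i : ℕ) : ℕ := (((List.range i).map φ).map List.length).sum

/-- The minimal `i ≥ 1` with `j ≤ ℓ(a^1) + ⋯ + ℓ(a^i)`. -/
noncomputable def relabel (φ : ℕ → PWord) (j : ℤ) : ℤ :=
  ((sInf {i : ℕ | 1 ≤ i ∧ j ≤ (prefLen φ i : ℤ)} : ℕ) : ℤ)

/-- The semistandard recording tableau `Q_EGᴼ(φ)`. -/
noncomputable def QEGseq (φ : ℕ → PWord) : STab :=
  (QEG (concatSeq φ)).map (List.map (fun x => (⟨relabel φ x.ceil, x.primed⟩ : Letter)))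

/-- The insertion tableau `P_EGᴼ(φ)`. -/
noncomputable def PEGseq (φ : ℕ → PWord) : STab := PEG (concatSeq φ)

/-- The Schur Q-function of a strict partition: the coefficient of the monomial with
exponent vector `d` is the number of semistandard shifted tableaux `T` of the given
shape with `x^T = x^d`. -/
noncomputable def SchurQ (sh : List ℕ) : MvPowerSeries ℤ ℤ :=
  fun d => (({T : STab | shapeOf T = sh ∧ IsSemistandard T ∧
    ∀ i : ℤ, d i = T.flatten.countP (fun x => decide (x.ceil = i))} : Set STab).ncard : ℤ)

/-- `Q_z = Σ_{φ ∈ Incr_∞(R_inv^+(z))} x^φ`. -/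
noncomputable def Qz (z : Equiv.Perm ℤ) : MvPowerSeries ℤ ℤ :=
  fun d => (({φ : ℕ → PWord | φ ∈ IncrSeq z ∧
    (∀ i : ℕ, d ((i : ℤ) + 1) = (φ i).length) ∧
    (∀ j : ℤ, j ≤ 0 → d j = 0)} : Set (ℕ → PWord)).ncard : ℤ)

/-! ## Dominant involutions -/

/-- The shifted diagram `SD_λ ⊆ ℤ × ℤ` of a strict partition. -/
def SDset (sh : List ℕ) : Set (ℤ × ℤ) :=
  {p | ∃ i j : ℕ, 1 ≤ i ∧ i ≤ sh.length ∧ 1 ≤ j ∧ j ≤ sh.getD (i - 1) 0 ∧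
    p.1 = (i : ℤ) ∧ p.2 = (i : ℤ) + (j : ℤ) - 1}

/-- The involution Rothe diagram `D̂(z) = {(i,j) : z(i) > j ≤ i < z(j)}`. -/
def invRothe (z : Equiv.Perm ℤ) : Set (ℤ × ℤ) :=
  {p | p.2 < z p.1 ∧ p.2 ≤ p.1 ∧ p.1 < z p.2}

/-- The tableau `T_λ` with entry `i + j - 1` in box `(i, j)` of `SD_λ`. -/
def Tlam (sh : List ℕ) : STab :=
  (List.range sh.length).map (fun r =>
    (List.range (sh.getD r 0)).map (fun k =>
      (⟨2 * (r : ℤ) + (k : ℤ) + 1, false⟩ : Letter)))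

/-- The permutation `i + m ↦ w(i) + m` (fixing everything outside `m + support`). -/
def shiftPerm (m : ℕ) (w : Equiv.Perm ℤ) : Equiv.Perm ℤ :=
  (Equiv.addLeft (m : ℤ)).permCongr w

/-- `z ∈ S_m`: `z` fixes every point outside `[1, m]`. -/
def SupportedOn (z : Equiv.Perm ℤ) (m : ℕ) : Prop :=
  ∀ x : ℤ, x < 1 ∨ (m : ℤ) < x → z x = x
/-! ## Primed compatible sequences -/

/-- A primed compatible sequence, recorded as the list of its columns `(index; value)`. -/
def IsPrimedCompatible (φ : List (ℕ × Letter)) : Prop :=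
  (∀ p ∈ φ, 0 < p.1 ∧ 0 < p.2.ceil) ∧
  List.Chain' (fun p q : ℕ × Letter => p.1 ≤ q.1 ∧ (p.1 = q.1 → p.2 ≤ q.2)) φ ∧
  (∀ (k l : ℕ) (p : ℕ × Letter), k < l → φ[k]? = some p → φ[l]? = some p →
    p.2.primed = false)

def IsIndexStrict (φ : List (ℕ × Letter)) : Prop :=
  List.Chain' (fun p q : ℕ × Letter => p.1 < q.1) φ

/-! ## Sagan–Worley insertion (orthogonal and symplectic versions) -/

/-- Whether `u` bumps `v`: strict comparison when inserting an unprimed letter into a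
row or a primed letter into a column, weak comparison otherwise. -/
def swBump (isRow : Bool) (u v : Letter) : Bool :=
  if (isRow && !u.primed) || (!isRow && u.primed) then decide (u < v) else decide (u ≤ v)

/-- Column stage of orthogonal Sagan–Worley insertion. -/
def swColO : ℕ → STab → ℕ → Letter → STab × Bool
  | 0, T, _, _ => (T, true)
  | fuel + 1, T, c, u =>
    let occ := (List.range (c + 1)).filterMap (fun r => (entry? T r c).map (fun x => (r, x)))
    match occ.find? (fun p => swBump false u p.2) with
    | none =>
        let r := occ.length
        let u' := if r = c ∧ u.primed then Letter.unprime u else u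
        (setRowG T r ((T.getD r []) ++ [u']), true)
    | some p =>
        if p.1 = c then
          if u.ceil = p.2.ceil then swColO fuel T (c + 1) (Letter.unprime p.2)
          else
            let q := switchPrimes u p.2
            swColO fuel (setEntryG T p.1 c q.1) (c + 1) q.2
        else swColO fuel (setEntryG T p.1 c u) (c + 1) p.2

/-- Row stage of orthogonal Sagan–Worley insertion. -/
def swRowO : ℕ → STab → ℕ → Letter → STab × Bool
  | 0, T, _, _ => (T, true)
  | fuel + 1, T, r, u =>
    let row := T.getD r []
    match row.findIdx? (fun v => swBump true u v) with
    | none =>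
        if row.isEmpty ∧ u.primed then (setRowG T r [Letter.unprime u], true)
        else (setRowG T r (row ++ [u]), false)
    | some k =>
        let v := row.getD k default
        if k = 0 then
          if u.ceil = v.ceil then swColO fuel T (r + 1) (Letter.unprime v)
          else
            let q := switchPrimes u v
            swColO fuel (setRowG T r (row.set 0 q.1)) (r + 1) q.2
        else swRowO fuel (setRowG T r (row.set k u)) (r + 1) v

def swInsertO (T : STab) (u : Letter) : STab × Bool :=
  swRowO (T.flatten.length + T.length + 2) T 0 u

/-- Column stage of symplectic (original) Sagan–Worley insertion. -/
def swColSp : ℕ → STab → ℕ → Letter → STab × Bool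
  | 0, T, _, _ => (T, true)
  | fuel + 1, T, c, u =>
    let occ := (List.range (c + 1)).filterMap (fun r => (entry? T r c).map (fun x => (r, x)))
    match occ.find? (fun p => swBump false u p.2) with
    | none => (setRowG T occ.length ((T.getD occ.length []) ++ [u]), true)
    | some p =>
        if p.1 = c then
          if u.ceil = p.2.ceil then swColSp fuel T (c + 1) (Letter.unprime p.2)
          else swColSp fuel (setEntryG T p.1 c u) (c + 1) p.2
        else swColSp fuel (setEntryG T p.1 c u) (c + 1) p.2

/-- Row stage of symplectic (original) Sagan–Worley insertion. -/
def swRowSp : ℕ → STab → ℕ → Letter → STab × Bool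
  | 0, T, _, _ => (T, true)
  | fuel + 1, T, r, u =>
    let row := T.getD r []
    match row.findIdx? (fun v => swBump true u v) with
    | none => (setRowG T r (row ++ [u]), false)
    | some k =>
        let v := row.getD k default
        if k = 0 then
          if u.ceil = v.ceil then swColSp fuel T (r + 1) (Letter.unprime v)
          else swColSp fuel (setRowG T r (row.set 0 u)) (r + 1) v
        else swRowSp fuel (setRowG T r (row.set k u)) (r + 1) v

def swInsertSp (T : STab) (u : Letter) : STab × Bool :=
  swRowSp (T.flatten.length + T.length + 2) T 0 u

def PSWO (φ : List (ℕ × Letter)) : STab := φ.foldl (fun T p => (swInsertO T p.2).1) []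

def PSWSp (φ : List (ℕ × Letter)) : STab := φ.foldl (fun T p => (swInsertSp T p.2).1) []

def QSWaux (ins : STab → Letter → STab × Bool) : STab → STab → List (ℕ × Letter) → STab
  | _, Q, [] => Q
  | P, Q, p :: rest =>
      let res := ins P p.2
      QSWaux ins res.1 (addBox Q P res.1 ⟨(p.1 : ℤ), res.2⟩) rest

def QSWO (φ : List (ℕ × Letter)) : STab := QSWaux swInsertO [] [] φ

def QSWSp (φ : List (ℕ × Letter)) : STab := QSWaux swInsertSp [] [] φ

/-- Entry `A_{ij}` of the circled matrix of `φ` (forgetting the circles). -/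
def cmEntry (φ : List (ℕ × Letter)) (i j : ℕ) : ℕ :=
  φ.countP (fun p => decide (p.1 = i ∧ p.2.ceil = (j : ℤ)))

/-! ## Shifted mixed insertion (orthogonal and symplectic versions) -/

/-- Tableaux whose entries are signed letters `(ε, u)`, `ε ∈ {+, -}`
(`true` records the sign `-`). -/
abbrev MTab := List (List (Bool × Letter))

def extractO (U : MTab) : STab :=
  U.map (fun row =>
    match row with
    | [] => []
    | (e, x) :: rest => (if e then (⟨x.ceil, true⟩ : Letter) else x) :: rest.map Prod.snd)

def extractSp (U : MTab) : STab := U.map (List.map Prod.snd)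

/-- One mixed insertion, of the pair `β` into row (`isCol = false`) or column
(`isCol = true`) number `idx`; returns the tableau and the added box. -/
def hmIns (sympl : Bool) : ℕ → MTab → Bool → ℕ → Bool × Letter → MTab × (ℕ × ℕ)
  | 0, T, _, _, _ => (T, (0, 0))
  | fuel + 1, T, isCol, idx, β =>
    if isCol then
      let c := idx
      let occ := (List.range (c + 1)).filterMap
        (fun r => (entryG? T r c).map (fun x => (r, x)))
      match occ.find? (fun p => decide (β.2 < p.2.2)) with
      | none =>
          let r := occ.length
          (setRowG T r ((T.getD r []) ++ [β]), (r, c))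
      | some p =>
          if p.1 = c then
            hmIns sympl fuel
              (setEntryG T p.1 c (if sympl then (p.2.1, β.2) else β)) true (c + 1)
              (if sympl then (β.1, ⟨p.2.2.ceil, true⟩) else (p.2.1, ⟨p.2.2.ceil, true⟩))
          else
            hmIns sympl fuel (setEntryG T p.1 c (p.2.1, β.2)) p.2.2.primed
              (if p.2.2.primed then c + 1 else p.1 + 1) (β.1, p.2.2)
    else
      let r := idx
      let row := T.getD r []
      match row.findIdx? (fun p => decide (β.2 < p.2)) with
      | none => (setRowG T r (row ++ [β]), (r, r + row.length))
      | some k =>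
          let q := row.getD k default
          if k = 0 then
            hmIns sympl fuel
              (setRowG T r (row.set 0 (if sympl then (q.1, β.2) else β))) true (r + 1)
              (if sympl then (β.1, ⟨q.2.ceil, true⟩) else (q.1, ⟨q.2.ceil, true⟩))
          else
            hmIns sympl fuel (setRowG T r (row.set k (q.1, β.2))) q.2.primed
              (if q.2.primed then r + k + 1 else r + 1) (β.1, q.2)

def hmInsert (sympl : Bool) (T : MTab) (x : Letter) : MTab × (ℕ × ℕ) :=
  hmIns sympl (2 * T.flatten.length + 4) T false 0 (x.primed, ⟨x.ceil, false⟩)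

def hmAuxCS (sympl : Bool) : MTab → STab → List (ℕ × Letter) → MTab × STab
  | U, Q, [] => (U, Q)
  | U, Q, p :: rest =>
      let res := hmInsert sympl U p.2
      let pos := res.2
      let sgn := ((entryG? res.1 pos.1 pos.2).map Prod.fst).getD false
      let pr : Bool := if sympl then sgn else (decide (pos.1 ≠ pos.2) && sgn)
      hmAuxCS sympl res.1
        (setRowG Q pos.1 ((Q.getD pos.1 []) ++ [(⟨(p.1 : ℤ), pr⟩ : Letter)])) rest

def PHMO (φ : List (ℕ × Letter)) : STab := extractO (hmAuxCS false [] [] φ).1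
def QHMO (φ : List (ℕ × Letter)) : STab := (hmAuxCS false [] [] φ).2
def PHMSp (φ : List (ℕ × Letter)) : STab := extractSp (hmAuxCS true [] [] φ).1
def QHMSp (φ : List (ℕ × Letter)) : STab := (hmAuxCS true [] [] φ).2

/-- A primed word, identified with the primed compatible sequence with
index row `1, 2, …, n`. -/
def wordCS (a : PWord) : List (ℕ × Letter) :=
  ((List.range a.length).zip a).map (fun p => (p.1 + 1, p.2))

/-! ## The transpose of a primed compatible sequence -/

def insSortedCS (p : ℕ × Letter) : List (ℕ × Letter) → List (ℕ × Letter)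
  | [] => [p]
  | q :: rest =>
      if p.1 < q.1 ∨ (p.1 = q.1 ∧ p.2 ≤ q.2) then p :: q :: rest
      else q :: insSortedCS p rest

def sortCS (l : List (ℕ × Letter)) : List (ℕ × Letter) := l.foldr insSortedCS []

/-- `φ^⊤`: move each prime from the value to the index above it, interchange the two
rows, and reorder the columns lexicographically. -/
def transposeCS (φ : List (ℕ × Letter)) : List (ℕ × Letter) :=
  sortCS (φ.map (fun p => (p.2.ceil.toNat, (⟨(p.1 : ℤ), p.2.primed⟩ : Letter))))

/-! ## Local configurations of three consecutive boxes -/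

/-- A box of a tableau together with the prime of its entry. -/
structure Cell where
  row : ℕ
  col : ℕ
  primed : Bool

/-- The index `k` of the factor `C_k R_k` of the shifted reading word containing the entry. -/
def Cell.block (a : Cell) : ℕ := if a.primed then a.col else a.row

def Cell.OnDiag (a : Cell) : Prop := a.row = a.col

instance (a : Cell) : Decidable a.OnDiag := by unfold Cell.OnDiag; infer_instance

/-- The boxes share neither a row nor a column. -/
def Cell.Apart (a b : Cell) : Prop := a.row ≠ b.row ∧ a.col ≠ b.col

instance (a b : Cell) : Decidable (a.Apart b) := by unfold Cell.Apart; infer_instance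

/-- When the entry of `a` is smaller than that of `b`, whether it precedes the entry of `b` in
the shifted reading word. -/
def Cell.Before (a b : Cell) : Prop :=
  b.block < a.block ∨ b.block = a.block ∧ (a.primed = true ∨ b.primed = false)

instance (a b : Cell) : Decidable (a.Before b) := by unfold Cell.Before; infer_instance

def Cell.Dominated (a b : Cell) : Prop := a.row ≤ b.row ∧ a.col ≤ b.col

/-- The possible effects of `𝔡_i` on the entries `i`, `i + 1` and `i + 2`: exchange two of the
values, or reverse some of the primes. -/
inductive Effect where
  | swap01
  | swap12
  | toggle (t0 t1 t2 : Bool)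

/-- The relative positions allowed for the boxes of three consecutive values. -/
structure Consecutive (a b c : Cell) : Prop where
  le_a : a.row ≤ a.col
  le_b : b.row ≤ b.col
  le_c : c.row ≤ c.col
  not_ba : ¬ b.Dominated a
  not_cb : ¬ c.Dominated b
  not_ca : ¬ c.Dominated a
  adj_ab : a.Dominated b →
    b.row = a.row ∧ b.col = a.col + 1 ∨ b.row = a.row + 1 ∧ b.col = a.col
  adj_bc : b.Dominated c →
    c.row = b.row ∧ c.col = b.col + 1 ∨ c.row = b.row + 1 ∧ c.col = b.col
  adj_ac : a.Dominated c →
    (c.row = a.row ∧ c.col = a.col + 1 ∨ c.row = a.row + 1 ∧ c.col = a.col) ∨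
    (c.row = a.row ∧ c.col = a.col + 2 ∧ b.row = a.row ∧ b.col = a.col + 1) ∨
    (c.row = a.row + 2 ∧ c.col = a.col ∧ b.row = a.row + 1 ∧ b.col = a.col) ∨
    (c.row = a.row + 1 ∧ c.col = a.col + 1 ∧ b.row = a.row ∧ b.col = a.col + 1 ∧
      a.row = a.col)

/-- The value `i + 2` lies between `i` and `i + 1` in the shifted reading word. -/
def TopBetween (a b c : Cell) : Prop := ¬ (a.Before c ↔ b.Before c)

/-- The value `i` lies between `i + 1` and `i + 2` in the shifted reading word. -/
def BotBetween (a b c : Cell) : Prop := ¬ (a.Before b ↔ a.Before c)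

instance (a b c : Cell) : Decidable (TopBetween a b c) := by unfold TopBetween; infer_instance
instance (a b c : Cell) : Decidable (BotBetween a b c) := by unfold BotBetween; infer_instance

/-- The effect of `𝔡_i` when `i`, `i + 1` and `i + 2` occupy the cells `a`, `b` and `c`. -/
def effect (a b c : Cell) : Effect :=
  if TopBetween a b c then
    if a.Apart b then .swap01
    else if a.OnDiag then
      if c.OnDiag ∧ a.primed ≠ c.primed then .toggle true true true
      else .toggle false true false
    else .toggle true true false
  else if BotBetween a b c then
    if b.Apart c then .swap12
    else if c.OnDiag then
      if a.OnDiag ∧ a.primed ≠ c.primed then .toggle true true true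
      else .toggle false true false
    else .toggle false true true
  else .toggle false false false

theorem Consecutive.not_onDiag_of_topBetween {a b c : Cell} (h : Consecutive a b c)
    (ht : TopBetween a b c) (hab : ¬ a.Apart b) : ¬ b.OnDiag := by
  obtain ⟨ra, ca, pa⟩ := a
  obtain ⟨rb, cb, pb⟩ := b
  obtain ⟨rc, cc, pc⟩ := c
  obtain ⟨h1, h2, h3, h4, h5, h6, h7, h8, h9⟩ := h
  simp only [TopBetween, Cell.Before, Cell.Apart, Cell.OnDiag, Cell.Dominated, Cell.block] at *
  cases pa <;> cases pb <;> cases pc <;>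
    simp only [Bool.false_eq_true, if_false, if_true, reduceCtorEq, or_false, or_true,
      and_true, and_false] at ht <;> omega

theorem Consecutive.not_onDiag_of_botBetween {a b c : Cell} (h : Consecutive a b c)
    (ht : BotBetween a b c) (hbc : ¬ b.Apart c) : ¬ b.OnDiag := by
  obtain ⟨ra, ca, pa⟩ := a
  obtain ⟨rb, cb, pb⟩ := b
  obtain ⟨rc, cc, pc⟩ := c
  obtain ⟨h1, h2, h3, h4, h5, h6, h7, h8, h9⟩ := h
  simp only [BotBetween, Cell.Before, Cell.Apart, Cell.OnDiag, Cell.Dominated, Cell.block] at *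
  cases pa <;> cases pb <;> cases pc <;>
    simp only [Bool.false_eq_true, if_false, if_true, reduceCtorEq, or_false, or_true,
      and_true, and_false] at ht <;> omega

def Cell.flip (a : Cell) (t : Bool) : Cell := ⟨a.row, a.col, xor a.primed t⟩

/-- The cells of `i`, `i + 1` and `i + 2` after the effect has taken place. -/
def Effect.act : Effect → Cell → Cell → Cell → Cell × Cell × Cell
  | .swap01, a, b, c => (b, a, c)
  | .swap12, a, b, c => (a, c, b)
  | .toggle t0 t1 t2, a, b, c => (a.flip t0, b.flip t1, c.flip t2)

theorem Cell.Apart.symm {a b : Cell} (h : a.Apart b) : b.Apart a := ⟨h.1.symm, h.2.symm⟩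

theorem Cell.Apart.before_comm {a b : Cell} (h : a.Apart b) : b.Before a ↔ ¬ a.Before b := by
  obtain ⟨ra, ca, pa⟩ := a
  obtain ⟨rb, cb, pb⟩ := b
  obtain ⟨h1, h2⟩ := h
  cases pa <;> cases pb <;> simp [Cell.Before, Cell.block] at * <;> omega

theorem Cell.flip_false (a : Cell) : a.flip false = a := by
  simp [Cell.flip]

theorem Consecutive.topBetween_flip_ab {a b c : Cell} (h : Consecutive a b c)
    (ht : TopBetween a b c) (hab : ¬ a.Apart b) (ha : ¬ a.OnDiag) :
    TopBetween (a.flip true) (b.flip true) c := by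
  obtain ⟨ra, ca, pa⟩ := a
  obtain ⟨rb, cb, pb⟩ := b
  obtain ⟨rc, cc, pc⟩ := c
  obtain ⟨h1, h2, h3, h4, h5, h6, h7, h8, h9⟩ := h
  simp only [TopBetween, Cell.Before, Cell.Apart, Cell.OnDiag, Cell.Dominated,
    Cell.block, Cell.flip] at *
  cases pa <;> cases pb <;> cases pc <;>
    simp only [Bool.xor_true, Bool.not_true, Bool.not_false, Bool.false_eq_true, if_false,
      if_true, reduceCtorEq, or_false, or_true, and_true, and_false] at ht ⊢ <;> omega

theorem Consecutive.topBetween_flip_b {a b c : Cell} (h : Consecutive a b c)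
    (ht : TopBetween a b c) (hab : ¬ a.Apart b) (ha : a.OnDiag) (hc : ¬ c.OnDiag) :
    TopBetween a (b.flip true) c := by
  obtain ⟨ra, ca, pa⟩ := a
  obtain ⟨rb, cb, pb⟩ := b
  obtain ⟨rc, cc, pc⟩ := c
  obtain ⟨h1, h2, h3, h4, h5, h6, h7, h8, h9⟩ := h
  simp only [TopBetween, Cell.Before, Cell.Apart, Cell.OnDiag, Cell.Dominated,
    Cell.block, Cell.flip] at *
  cases pa <;> cases pb <;> cases pc <;>
    simp only [Bool.xor_true, Bool.not_true, Bool.not_false, Bool.false_eq_true, if_false,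
      if_true, reduceCtorEq, or_false, or_true, and_true, and_false] at ht ⊢ <;> omega

theorem Consecutive.botBetween_flip_bc {a b c : Cell} (h : Consecutive a b c)
    (ht : ¬ TopBetween a b c) (hb : BotBetween a b c) (hbc : ¬ b.Apart c) (hc : ¬ c.OnDiag) :
    ¬ TopBetween a (b.flip true) (c.flip true) ∧ BotBetween a (b.flip true) (c.flip true) := by
  obtain ⟨ra, ca, pa⟩ := a
  obtain ⟨rb, cb, pb⟩ := b
  obtain ⟨rc, cc, pc⟩ := c
  obtain ⟨h1, h2, h3, h4, h5, h6, h7, h8, h9⟩ := h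
  simp only [TopBetween, BotBetween, Cell.Before, Cell.Apart, Cell.OnDiag, Cell.Dominated,
    Cell.block, Cell.flip] at *
  cases pa <;> cases pb <;> cases pc <;>
    simp only [Bool.xor_true, Bool.not_true, Bool.not_false, Bool.false_eq_true, if_false,
      if_true, reduceCtorEq, or_false, or_true, and_true, and_false] at ht hb ⊢ <;> omega

theorem Consecutive.botBetween_flip_b {a b c : Cell} (h : Consecutive a b c)
    (ht : ¬ TopBetween a b c) (hb : BotBetween a b c) (hbc : ¬ b.Apart c) (ha : ¬ a.OnDiag)
    (hc : c.OnDiag) :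
    ¬ TopBetween a (b.flip true) c ∧ BotBetween a (b.flip true) c := by
  obtain ⟨ra, ca, pa⟩ := a
  obtain ⟨rb, cb, pb⟩ := b
  obtain ⟨rc, cc, pc⟩ := c
  obtain ⟨h1, h2, h3, h4, h5, h6, h7, h8, h9⟩ := h
  simp only [TopBetween, BotBetween, Cell.Before, Cell.Apart, Cell.OnDiag, Cell.Dominated,
    Cell.block, Cell.flip] at *
  cases pa <;> cases pb <;> cases pc <;>
    simp only [Bool.xor_true, Bool.not_true, Bool.not_false, Bool.false_eq_true, if_false,
      if_true, reduceCtorEq, or_false, or_true, and_true, and_false] at ht hb ⊢ <;> omega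

theorem Consecutive.effect_eq_toggle_of_onDiag {a b c : Cell} (h : Consecutive a b c)
    (ha : a.OnDiag) (hc : c.OnDiag) :
    effect a b c = .toggle (xor a.primed c.primed) true (xor a.primed c.primed) := by
  obtain ⟨ra, ca, pa⟩ := a
  obtain ⟨rb, cb, pb⟩ := b
  obtain ⟨rc, cc, pc⟩ := c
  obtain ⟨h1, h2, h3, h4, h5, h6, h7, h8, h9⟩ := h
  simp only [Cell.Dominated, Cell.OnDiag] at *
  unfold effect
  cases pa <;> cases pb <;> cases pc <;> 
    simp [TopBetween, BotBetween, Cell.Before, Cell.Apart, Cell.OnDiag, Cell.block] at * <;>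
    split_ifs <;> first | rfl | (exfalso; omega)

theorem Consecutive.effect_act {a b c a' b' c' : Cell} (h : Consecutive a b c)
    (h' : Consecutive a' b' c') (hact : (effect a b c).act a b c = (a', b', c')) :
    effect a' b' c' = effect a b c := by
  by_cases hd : a.OnDiag ∧ c.OnDiag
  · rw [h.effect_eq_toggle_of_onDiag hd.1 hd.2] at hact ⊢
    obtain ⟨rfl, rfl, rfl⟩ := hact
    rw [h'.effect_eq_toggle_of_onDiag hd.1 hd.2]
    cases ha : a.primed <;> cases hc : c.primed <;> simp [Cell.flip, ha, hc]
  have e : effect a b c =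
      if TopBetween a b c then
        if a.Apart b then .swap01
        else if a.OnDiag then .toggle false true false else .toggle true true false
      else if BotBetween a b c then
        if b.Apart c then .swap12
        else if c.OnDiag then .toggle false true false else .toggle false true true
      else .toggle false false false := by
    unfold effect
    split_ifs <;> first | rfl | (exfalso; tauto)
  rw [e] at hact ⊢
  split_ifs at hact ⊢ with ht hab ha hb hbc hc
  all_goals
    simp only [Effect.act, Cell.flip_false] at hact
    obtain ⟨rfl, rfl, rfl⟩ := hact
  · have ht' : TopBetween b a c := fun hn => ht hn.symm
    simp [effect, ht', hab.symm]
  · have hc : ¬ c.OnDiag := fun hc => hd ⟨ha, hc⟩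
    have hab' : ¬ a.Apart (b.flip true) := hab
    simp [effect, h.topBetween_flip_b ht hab ha hc, hab', ha, hc]
  · have hab' : ¬ (a.flip true).Apart (b.flip true) := hab
    have ha' : ¬ (a.flip true).OnDiag := ha
    simp [effect, h.topBetween_flip_ab ht hab ha, hab', ha']
  · have hb' : BotBetween a c b := fun hn => hb hn.symm
    have ht' : ¬ TopBetween a c b := by
      have := hbc.before_comm
      simp only [TopBetween, BotBetween] at *
      tauto
    simp [effect, ht', hb', hbc.symm]
  · have ha : ¬ a.OnDiag := fun ha => hd ⟨ha, hc⟩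
    have hbc' : ¬ (b.flip true).Apart c := hbc
    have := h.botBetween_flip_b ht hb hbc ha hc
    simp [effect, this.1, this.2, hbc', ha, hc]
  · have hbc' : ¬ (b.flip true).Apart (c.flip true) := hbc
    have hc' : ¬ (c.flip true).OnDiag := hc
    have := h.botBetween_flip_bc ht hb hbc hc
    simp [effect, this.1, this.2, hbc', hc']
  · simp [effect, ht, hb]

/-- The number of primed cells among three. -/
def primeCount (a b c : Cell) : ℕ := a.primed.toNat + b.primed.toNat + c.primed.toNat

theorem Consecutive.effect_toggle_of_not_onDiag {a b c : Cell} {t0 t1 t2 : Bool}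
    (h : Consecutive a b c)
    (hd : ¬ (a.OnDiag ∧ c.OnDiag)) (he : effect a b c = .toggle t0 t1 t2) :
    primeCount (a.flip t0) (b.flip t1) (c.flip t2) = primeCount a b c ∧
      (a.OnDiag → t0 = false) ∧ (b.OnDiag → t1 = false) ∧ (c.OnDiag → t2 = false) := by
  obtain ⟨ra, ca, pa⟩ := a
  obtain ⟨rb, cb, pb⟩ := b
  obtain ⟨rc, cc, pc⟩ := c
  obtain ⟨h1, h2, h3, h4, h5, h6, h7, h8, h9⟩ := h
  unfold effect at he
  simp only [Cell.Dominated] at *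
  cases pa <;> cases pb <;> cases pc <;> split_ifs at he <;>
    simp only [Effect.toggle.injEq] at he <;>
    obtain ⟨rfl, rfl, rfl⟩ := he <;>
    simp [TopBetween, BotBetween, Cell.Before, Cell.Apart, Cell.OnDiag, Cell.block, primeCount,
      Cell.flip] at * <;>
    omega

/-! ## Entries of shifted tableaux -/

/-- Apply a function to every entry of a tableau. -/
def tabMap (g : Letter → Letter) (T : STab) : STab := T.map (List.map g)

/-- The properties of standard shifted tableaux which the operators `𝔡_i` preserve. -/
structure IsStd (T : STab) : Prop where
  shifted : IsShifted T
  nodup : (T.flatten.map Letter.ceil).Nodup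
  mem_iff : ∀ a : ℤ, a ∈ T.flatten.map Letter.ceil ↔ 1 ≤ a ∧ a ≤ T.flatten.length
  row_lt : ∀ r c x y, entry? T r c = some x → entry? T r (c + 1) = some y → x.ceil < y.ceil
  col_lt : ∀ r c x y, entry? T r c = some x → entry? T (r + 1) c = some y → x.ceil < y.ceil

theorem entry?_eq_some {T : STab} {r c : ℕ} {x : Letter} :
    entry? T r c = some x ↔ r ≤ c ∧ (T.getD r [])[c - r]? = some x := by
  unfold entry? entryG?
  rw [List.getD_eq_getElem?_getD]
  cases h : T[r]? <;> split_ifs <;> simp_all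

theorem exists_entry?_iff {T : STab} {r c : ℕ} :
    (∃ x, entry? T r c = some x) ↔ r ≤ c ∧ c - r < (T.getD r []).length := by
  simp only [entry?_eq_some]
  constructor
  · rintro ⟨x, h, hx⟩
    exact ⟨h, (List.getElem?_eq_some_iff.1 hx).1⟩
  · rintro ⟨h, hx⟩
    exact ⟨_, h, List.getElem?_eq_getElem hx⟩

theorem entry?_of_not_le {T : STab} {r c : ℕ} (h : ¬ r ≤ c) : entry? T r c = none := by
  simp [entry?, entryG?, h]

theorem entry?_tabMap (g : Letter → Letter) (T : STab) (r c : ℕ) :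
    entry? (tabMap g T) r c = (entry? T r c).map g := by
  unfold entry? entryG? tabMap
  split_ifs
  · cases h : T[r]? <;> simp [h]
  · rfl

theorem flatten_tabMap (g : Letter → Letter) (T : STab) :
    (tabMap g T).flatten = T.flatten.map g := by
  simp [tabMap, List.map_flatten]

theorem tabMap_tabMap (f g : Letter → Letter) (T : STab) :
    tabMap f (tabMap g T) = tabMap (f ∘ g) T := by
  simp [tabMap]

theorem tabMap_id (T : STab) : tabMap id T = T := by
  simp [tabMap]

theorem mem_flatten_iff_entry? {T : STab} {x : Letter} :
    x ∈ T.flatten ↔ ∃ r c, entry? T r c = some x := by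
  simp only [entry?_eq_some, List.mem_flatten]
  constructor
  · rintro ⟨l, hl, hx⟩
    obtain ⟨r, hr, rfl⟩ := List.getElem_of_mem hl
    obtain ⟨k, hk, rfl⟩ := List.getElem_of_mem hx
    refine ⟨r, r + k, Nat.le_add_right _ _, ?_⟩
    simp [List.getD_eq_getElem?_getD, hr, hk]
  · rintro ⟨r, c, -, h⟩
    rw [List.getD_eq_getElem?_getD] at h
    cases hT : T[r]? with
    | none => simp [hT] at h
    | some l =>
      rw [hT] at h
      exact ⟨l, List.mem_of_getElem? hT, List.mem_of_getElem? h⟩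

/-- Tableaux of the same shape with the same entries are equal. -/
theorem eq_of_entry?_eq {T U : STab} (hs : shapeOf T = shapeOf U)
    (h : ∀ r c, entry? T r c = entry? U r c) : T = U := by
  have hl : T.length = U.length := by simpa [shapeOf] using congrArg List.length hs
  refine List.ext_getElem hl fun r h1 h2 => List.ext_getElem? fun k => ?_
  have := h r (r + k)
  simpa [entry?, entryG?, h1, h2] using this

theorem IsShifted.length_getD_succ {T : STab} (h : IsShifted T) (r : ℕ)
    (hr : 0 < (T.getD (r + 1) []).length) :
    (T.getD (r + 1) []).length < (T.getD r []).length := by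
  have h1 : r + 1 < T.length := by
    by_contra hn
    simp [List.getD_eq_getElem?_getD, List.getElem?_eq_none (not_lt.1 hn)] at hr
  have := List.isChain_iff_getElem.1 h.1 r (by simpa [shapeOf] using h1)
  simpa [shapeOf, List.getD_eq_getElem?_getD, h1, Nat.lt_of_succ_lt h1] using this

theorem exists_entry?_left {T : STab} {r c c' : ℕ}
    (h : ∃ x, entry? T r c = some x) (h1 : r ≤ c') (h2 : c' ≤ c) :
    ∃ x, entry? T r c' = some x := by
  rw [exists_entry?_iff] at *
  omega

theorem IsShifted.exists_below {T : STab} (hT : IsShifted T) {r c : ℕ}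
    (h : ∃ x, entry? T (r + 1) c = some x) : ∃ x, entry? T r c = some x := by
  rw [exists_entry?_iff] at *
  have := hT.length_getD_succ r (by omega)
  omega

theorem IsShifted.exists_below_le {T : STab} (hT : IsShifted T) {r r' c : ℕ}
    (h : ∃ x, entry? T r c = some x) (hr : r' ≤ r) : ∃ x, entry? T r' c = some x := by
  induction r, hr using Nat.le_induction with
  | base => exact h
  | succ n _ ih => exact ih (hT.exists_below h)

theorem IsShifted.exists_dominated {T : STab} (hT : IsShifted T) {r c r' c' : ℕ}
    (h : ∃ x, entry? T r c = some x) (hr : r' ≤ r) (hc : c' ≤ c) (hrc : r' ≤ c') :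
    ∃ x, entry? T r' c' = some x :=
  exists_entry?_left (hT.exists_below_le h hr) hrc hc

theorem eq_of_ceil_eq_of_nodup {T : STab} (hnd : (T.flatten.map Letter.ceil).Nodup)
    {r c r' c' : ℕ} {x y : Letter}
    (hx : entry? T r c = some x) (hy : entry? T r' c' = some y) (h : x.ceil = y.ceil) :
    r = r' ∧ c = c' := by
  rw [List.map_flatten, List.nodup_flatten] at hnd
  obtain ⟨hrow, hdisj⟩ := hnd
  rw [entry?_eq_some] at hx hy
  obtain ⟨hrc, hx⟩ := hx
  obtain ⟨hrc', hy⟩ := hy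
  have key : ∀ {r k : ℕ} {x : Letter}, (T.getD r [])[k]? = some x →
      ∃ hr : r < (T.map (List.map Letter.ceil)).length,
        ((T.map (List.map Letter.ceil))[r])[k]? = some x.ceil := by
    intro r k x h
    have hr : r < T.length := by
      by_contra hn
      simp [List.getD_eq_getElem?_getD, List.getElem?_eq_none (not_lt.1 hn)] at h
    refine ⟨by simpa using hr, ?_⟩
    simp only [List.getD_eq_getElem?_getD, List.getElem?_eq_getElem hr, Option.getD_some] at h
    simp [h]
  obtain ⟨hr, hx⟩ := key hx
  obtain ⟨hr', hy⟩ := key hy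
  have hrr : r = r' := by
    rcases lt_trichotomy r r' with hlt | heq | hlt
    · exact absurd (h ▸ List.mem_of_getElem? hy)
        (fun hm => List.pairwise_iff_getElem.1 hdisj r r' hr hr' hlt (List.mem_of_getElem? hx) hm)
    · exact heq
    · exact absurd (List.mem_of_getElem? hy)
        (fun hm => List.pairwise_iff_getElem.1 hdisj r' r hr' hr hlt hm
          (h ▸ List.mem_of_getElem? hx))
  subst hrr
  refine ⟨rfl, ?_⟩
  have hk := (List.getElem?_eq_some_iff.1 hx).1
  have := (List.getElem?_inj hk (hrow _ (List.getElem_mem hr))).1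
    (hx.trans ((congrArg some h).trans hy.symm))
  omega

theorem IsStd.eq_of_ceil_eq {T : STab} (hT : IsStd T) {r c r' c' : ℕ} {x y : Letter}
    (hx : entry? T r c = some x) (hy : entry? T r' c' = some y) (h : x.ceil = y.ceil) :
    r = r' ∧ c = c' :=
  eq_of_ceil_eq_of_nodup hT.nodup hx hy h

theorem IsStd.exists_entry? {T : STab} (hT : IsStd T) {a : ℤ} (h1 : 1 ≤ a)
    (h2 : a ≤ T.flatten.length) : ∃ r c p, entry? T r c = some ⟨a, p⟩ := by
  obtain ⟨x, hx, rfl⟩ := List.mem_map.1 ((hT.mem_iff a).2 ⟨h1, h2⟩)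
  obtain ⟨r, c, h⟩ := mem_flatten_iff_entry?.1 hx
  exact ⟨r, c, x.primed, h⟩

theorem IsStd.ceil_bounds {T : STab} (hT : IsStd T) {r c : ℕ} {x : Letter}
    (hx : entry? T r c = some x) : 1 ≤ x.ceil ∧ x.ceil ≤ T.flatten.length :=
  (hT.mem_iff _).1 (List.mem_map_of_mem (mem_flatten_iff_entry?.2 ⟨r, c, hx⟩))

theorem IsStd.ceil_le_of_row {T : STab} (hT : IsStd T) {r c c' : ℕ} {x y : Letter}
    (hx : entry? T r c = some x) (hy : entry? T r c' = some y) (hc : c ≤ c') :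
    x.ceil ≤ y.ceil := by
  induction c', hc using Nat.le_induction generalizing y with
  | base => simp_all
  | succ n hn ih =>
    obtain ⟨z, hz⟩ := exists_entry?_left ⟨y, hy⟩
      ((entry?_eq_some.1 hx).1.trans hn) (Nat.le_succ n)
    exact (ih hz).trans (hT.row_lt _ _ _ _ hz hy).le

theorem IsStd.ceil_le_of_col {T : STab} (hT : IsStd T) {r r' c : ℕ} {x y : Letter}
    (hx : entry? T r c = some x) (hy : entry? T r' c = some y) (hr : r ≤ r') :
    x.ceil ≤ y.ceil := by
  induction r', hr using Nat.le_induction generalizing y with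
  | base => simp_all
  | succ n hn ih =>
    obtain ⟨z, hz⟩ := hT.shifted.exists_below ⟨y, hy⟩
    exact (ih hz).trans (hT.col_lt _ _ _ _ hz hy).le

theorem IsStd.ceil_le {T : STab} (hT : IsStd T) {r c r' c' : ℕ} {x y : Letter}
    (hx : entry? T r c = some x) (hy : entry? T r' c' = some y) (hr : r ≤ r') (hc : c ≤ c') :
    x.ceil ≤ y.ceil := by
  obtain ⟨z, hz⟩ := hT.shifted.exists_dominated ⟨y, hy⟩ hr le_rfl
    ((entry?_eq_some.1 hx).1.trans hc)
  exact (hT.ceil_le_of_row hx hz hc).trans (hT.ceil_le_of_col hz hy hr)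

theorem lt_ceil_le {x y : Letter} (h : x < y) : x.ceil ≤ y.ceil := by
  have h' : toLex (x.ceil, !x.primed) < toLex (y.ceil, !y.primed) := h
  rw [Prod.Lex.toLex_lt_toLex] at h'
  rcases h' with h' | h'
  · exact le_of_lt h'
  · exact le_of_eq h'.1

theorem isStd_of_isStandard {T : STab} (hs : IsShifted T) (h : IsStandard T) : IsStd T := by
  have hcount : ∀ i : ℤ, 1 ≤ i → i ≤ (T.flatten.length : ℤ) →
      (T.flatten.map Letter.ceil).count i = 1 := by
    intro i h1 h2
    rw [← h.2 i h1 h2, List.count, List.countP_map]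
    congr 1
  set L := T.flatten.map Letter.ceil with hL
  have hlen : L.length = T.flatten.length := by rw [hL, List.length_map]
  have hsub : Finset.Icc (1 : ℤ) T.flatten.length ⊆ L.toFinset := by
    intro a ha
    rw [Finset.mem_Icc] at ha
    rw [List.mem_toFinset]
    exact List.count_pos_iff.1 (by rw [hcount a ha.1 ha.2]; exact one_pos)
  have hcard : (Finset.Icc (1 : ℤ) T.flatten.length).card = L.length := by
    rw [Int.card_Icc, hlen]
    omega
  have heq : Finset.Icc (1 : ℤ) T.flatten.length = L.toFinset :=
    Finset.eq_of_subset_of_card_le hsub (hcard ▸ List.toFinset_card_le L)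
  have hnd : L.Nodup := by
    rw [← Multiset.coe_nodup, ← Multiset.toFinset_card_eq_card_iff_nodup]
    rw [heq] at hcard
    simpa using hcard
  have hmem : ∀ a : ℤ, a ∈ L ↔ 1 ≤ a ∧ a ≤ T.flatten.length := by
    intro a
    rw [← List.mem_toFinset, ← heq, Finset.mem_Icc]
  refine ⟨hs, hnd, hmem, fun r c x y hx hy => ?_, fun r c x y hx hy => ?_⟩
  · refine (lt_ceil_le (h.1.1 r c x y hx hy)).lt_of_ne fun he => ?_
    have := (eq_of_ceil_eq_of_nodup hnd hx hy he).2
    omega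
  · refine (lt_ceil_le (h.1.2 r c x y hx hy)).lt_of_ne fun he => ?_
    have := (eq_of_ceil_eq_of_nodup hnd hx hy he).1
    omega

theorem IsStd.boxOf_eq {T : STab} (hT : IsStd T) {r c : ℕ} {x : Letter}
    (hx : entry? T r c = some x) : boxOf T x.ceil = some (r, c) := by
  unfold boxOf
  have hpos : (r, c) ∈ positionsOf T := by
    obtain ⟨h1, h2⟩ := exists_entry?_iff.1 ⟨x, hx⟩
    have hr : r < T.length := by
      by_contra hn
      simp [List.getD_eq_getElem?_getD, List.getElem?_eq_none (not_lt.1 hn)] at h2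
    simp only [positionsOf, List.mem_flatMap, List.mem_range, List.mem_map, Prod.mk.injEq]
    exact ⟨r, hr, c - r, h2, rfl, by omega⟩
  cases hf : List.find? _ (positionsOf T) with
  | none =>
    have := List.find?_eq_none.1 hf _ hpos
    simp [hx] at this
  | some q =>
    have hq := List.find?_some hf
    obtain ⟨r', c'⟩ := q
    dsimp only at hq
    cases hy : entry? T r' c' with
    | none => simp [hy] at hq
    | some y =>
      rw [hy] at hq
      obtain ⟨rfl, rfl⟩ := hT.eq_of_ceil_eq hy hx (of_decide_eq_true hq)
      rfl

theorem exists_entry?_of_boxOf {T : STab} {v : ℤ} {r c : ℕ} (h : boxOf T v = some (r, c)) :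
    ∃ p, entry? T r c = some ⟨v, p⟩ := by
  have hq := List.find?_some h
  dsimp only at hq
  cases hy : entry? T r c with
  | none => simp [hy] at hq
  | some y =>
    rw [hy] at hq
    exact ⟨y.primed, by rw [← of_decide_eq_true hq]⟩

theorem boxOf_eq_none_of_lt {T : STab} (hT : IsStd T) {v : ℤ} (hv : (T.flatten.length : ℤ) < v) :
    boxOf T v = none := by
  cases h : boxOf T v with
  | none => rfl
  | some q =>
    obtain ⟨p, hp⟩ := exists_entry?_of_boxOf (r := q.1) (c := q.2) h
    have := (hT.ceil_bounds hp).2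
    simp only at this
    omega

theorem shapeOf_tabMap (g : Letter → Letter) (T : STab) : shapeOf (tabMap g T) = shapeOf T := by
  simp [shapeOf, tabMap]

/-- Relabelling the values of a standard tableau by an involution `s` gives a standard tableau
as long as the values of adjacent boxes stay in order. -/
theorem IsStd.isStd_tabMap {T : STab} (hT : IsStd T) {g : Letter → Letter} {s : ℤ → ℤ}
    (hg : ∀ x, (g x).ceil = s x.ceil) (hs : Function.Involutive s)
    (hn : ∀ a : ℤ, 1 ≤ a → a ≤ T.flatten.length → 1 ≤ s a ∧ s a ≤ T.flatten.length)
    (hadj : ∀ r c r' c' x y, entry? T r c = some x → entry? T r' c' = some y →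
      r = r' ∨ c = c' → x.ceil < y.ceil → s x.ceil < s y.ceil) :
    IsStd (tabMap g T) := by
  have hmap : (tabMap g T).flatten.map Letter.ceil = (T.flatten.map Letter.ceil).map s := by
    rw [flatten_tabMap, List.map_map, List.map_map]
    exact List.map_congr_left fun x _ => hg x
  have hlen : (tabMap g T).flatten.length = T.flatten.length := by
    rw [flatten_tabMap, List.length_map]
  refine ⟨?_, ?_, fun a => ?_, fun r c x y hx hy => ?_, fun r c x y hx hy => ?_⟩
  · rw [IsShifted, shapeOf_tabMap]
    exact hT.shifted
  · rw [hmap]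
    exact hT.nodup.map hs.injective
  · rw [hmap, hlen, List.mem_map]
    constructor
    · rintro ⟨b, hb, rfl⟩
      have := (hT.mem_iff b).1 hb
      exact hn b this.1 this.2
    · rintro ⟨h1, h2⟩
      exact ⟨s a, (hT.mem_iff _).2 (hn a h1 h2), hs a⟩
  all_goals
    rw [entry?_tabMap, Option.map_eq_some_iff] at hx hy
    obtain ⟨x, hx, rfl⟩ := hx
    obtain ⟨y, hy, rfl⟩ := hy
    rw [hg, hg]
  · exact hadj _ _ _ _ _ _ hx hy (Or.inl rfl) (hT.row_lt _ _ _ _ hx hy)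
  · exact hadj _ _ _ _ _ _ hx hy (Or.inr rfl) (hT.col_lt _ _ _ _ hx hy)

theorem shapeOf_setEntryG (T : STab) (r c : ℕ) (y : Letter) :
    shapeOf (setEntryG T r c y) = shapeOf T := by
  refine List.ext_getElem? fun k => ?_
  simp only [shapeOf, setEntryG, List.getElem?_map, List.getElem?_set]
  split_ifs with h1 h2
  · subst h1
    simp [h2]
  · subst h1
    simp [h2]
  · rfl

theorem entry?_setEntryG {T : STab} {r c : ℕ} {x : Letter} (hx : entry? T r c = some x)
    (y : Letter) (r' c' : ℕ) :
    entry? (setEntryG T r c y) r' c' = if r' = r ∧ c' = c then some y else entry? T r' c' := by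
  obtain ⟨hrc, hk⟩ := exists_entry?_iff.1 ⟨x, hx⟩
  have hr : r < T.length := by
    by_contra hn
    simp [List.getD_eq_getElem?_getD, List.getElem?_eq_none (not_lt.1 hn)] at hk
  by_cases hle : r' ≤ c'
  swap
  · rw [entry?_of_not_le hle, entry?_of_not_le hle, if_neg]
    rintro ⟨rfl, rfl⟩
    exact hle hrc
  by_cases h : r' = r
  · subst h
    simp only [entry?, entryG?, if_pos hle, setEntryG, List.getElem?_set_self hr, Option.bind_some,
      true_and]
    simp only [List.getD_eq_getElem?_getD, List.getElem?_eq_getElem hr, Option.getD_some,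
      Option.bind_some] at hk ⊢
    by_cases hc : c' = c
    · subst hc
      simp [hk]
    · rw [if_neg hc, List.getElem?_set_ne (by omega)]
  · simp only [entry?, entryG?, if_pos hle, setEntryG, List.getElem?_set_ne (Ne.symm h), h,
      false_and, if_false]

/-- Reverse the prime of the letter with value `v`. -/
def flipAt (v : ℤ) (x : Letter) : Letter := if x.ceil = v then ⟨x.ceil, !x.primed⟩ else x

theorem ceil_flipAt (v : ℤ) (x : Letter) : (flipAt v x).ceil = x.ceil := by
  unfold flipAt
  split_ifs <;> rfl

theorem IsStd.isStd_flipAt {T : STab} (hT : IsStd T) (v : ℤ) : IsStd (tabMap (flipAt v) T) :=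
  hT.isStd_tabMap (s := id) (ceil_flipAt v) (fun _ => rfl) (fun _ h1 h2 => ⟨h1, h2⟩)
    (fun _ _ _ _ _ _ _ _ _ h => h)

theorem IsStd.togglePos_eq {T : STab} (hT : IsStd T) {r c : ℕ} {x : Letter}
    (hx : entry? T r c = some x) : togglePos T r c = tabMap (flipAt x.ceil) T := by
  rw [togglePos, hx]
  refine eq_of_entry?_eq (by rw [shapeOf_setEntryG, shapeOf_tabMap]) fun r' c' => ?_
  rw [entry?_setEntryG hx, entry?_tabMap]
  split_ifs with h
  · obtain ⟨rfl, rfl⟩ := h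
    simp [hx, flipAt]
  · cases hy : entry? T r' c' with
    | none => rfl
    | some y =>
      have : y.ceil ≠ x.ceil := fun he => h (hT.eq_of_ceil_eq hy hx he)
      simp [flipAt, this]

/-- Exchange the values `u` and `v`, keeping the primes in place. -/
def swapAt (u v : ℤ) (x : Letter) : Letter := ⟨Equiv.swap u v x.ceil, x.primed⟩

theorem IsStd.setEntryG_setEntryG {T : STab} (hT : IsStd T) {r c r' c' : ℕ} {u v : ℤ}
    {p q : Bool} (hu : entry? T r c = some ⟨u, p⟩) (hv : entry? T r' c' = some ⟨v, q⟩)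
    (huv : u ≠ v) :
    setEntryG (setEntryG T r c ⟨v, p⟩) r' c' ⟨u, q⟩ = tabMap (swapAt u v) T := by
  have hne : ¬ (r' = r ∧ c' = c) := by
    rintro ⟨rfl, rfl⟩
    rw [hu] at hv
    simp_all
  have hv' : entry? (setEntryG T r c ⟨v, p⟩) r' c' = some ⟨v, q⟩ := by
    rw [entry?_setEntryG hu, if_neg hne, hv]
  refine eq_of_entry?_eq (by rw [shapeOf_setEntryG, shapeOf_setEntryG, shapeOf_tabMap])
    fun a b => ?_
  rw [entry?_setEntryG hv', entry?_setEntryG hu, entry?_tabMap]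
  split_ifs with h1 h2
  · obtain ⟨rfl, rfl⟩ := h1
    simp [hv, swapAt]
  · obtain ⟨rfl, rfl⟩ := h2
    simp [hu, swapAt]
  · cases hy : entry? T a b with
    | none => rfl
    | some y =>
      have h3 : y.ceil ≠ u := fun he => h2 (hT.eq_of_ceil_eq hy hu he)
      have h4 : y.ceil ≠ v := fun he => h1 (hT.eq_of_ceil_eq hy hv he)
      simp [swapAt, Equiv.swap_apply_of_ne_of_ne h3 h4]

/-! ## The shifted reading word -/

/-- The letter with value `v` of `T` has the box and the prime recorded by `a`. -/
def HasCell (T : STab) (v : ℤ) (a : Cell) : Prop := entry? T a.row a.col = some ⟨v, a.primed⟩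

/-- The order of letters in the shifted reading word. -/
def WordLT (T : STab) (x y : Letter) : Prop :=
  ∃ a b : Cell, HasCell T x.ceil a ∧ HasCell T y.ceil b ∧
    (b.block < a.block ∨ b.block = a.block ∧
      (a.primed = true ∧ b.primed = false ∨ a.primed = b.primed ∧ x.ceil < y.ceil))

/-- The factor `C_k R_k` of the shifted reading word, with primes. -/
def wordBlock (T : STab) (k : ℕ) : PWord :=
  (colLetters T k).filter (fun x => x.primed) ++ (T.getD k []).filter (fun x => !x.primed)

theorem shword_eq (T : STab) :
    shword T = (((List.range (numCols T)).reverse).flatMap (wordBlock T)).map Letter.ceil := rfl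

theorem mem_wordBlock {T : STab} {k : ℕ} {x : Letter} :
    x ∈ wordBlock T k ↔ ∃ a : Cell, HasCell T x.ceil a ∧ a.primed = x.primed ∧ a.block = k := by
  simp only [wordBlock, List.mem_append, List.mem_filter, colLetters, List.mem_filterMap,
    List.mem_range]
  constructor
  · rintro (⟨⟨r, -, h⟩, hp⟩ | ⟨h, hp⟩)
    · exact ⟨⟨r, k, x.primed⟩, h, rfl, by simp [Cell.block, hp]⟩
    · obtain ⟨j, hj⟩ := List.mem_iff_getElem?.1 h
      refine ⟨⟨k, k + j, x.primed⟩, ?_, rfl, by simp_all [Cell.block]⟩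
      exact entry?_eq_some.2 ⟨Nat.le_add_right _ _, by simpa using hj⟩
  · rintro ⟨⟨r, c, p⟩, h, rfl, hk⟩
    have h' := entry?_eq_some.1 h
    cases hp : x.primed
    · right
      simp only [Cell.block, hp] at hk
      subst hk
      exact ⟨List.mem_of_getElem? h'.2, rfl⟩
    · left
      simp only [Cell.block, hp] at hk
      subst hk
      exact ⟨⟨r, Nat.lt_succ_of_le h'.1, h⟩, rfl⟩

theorem IsStd.pairwise_wordBlock {T : STab} (hT : IsStd T) (k : ℕ) :
    (wordBlock T k).Pairwise (WordLT T) := by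
  refine List.pairwise_append.2 ⟨?_, ?_, fun x hx y hy => ?_⟩
  · rw [List.pairwise_filter, colLetters, List.pairwise_filterMap]
    refine List.pairwise_lt_range.imp fun {r r'} hr x hx y hy hpx hpy => ?_
    refine ⟨⟨r, k, x.primed⟩, ⟨r', k, y.primed⟩, hx, hy, Or.inr ⟨?_, Or.inr ⟨?_, ?_⟩⟩⟩
    · simp [Cell.block, hpx, hpy]
    · simp [hpx, hpy]
    · refine (hT.ceil_le_of_col hx hy hr.le).lt_of_ne fun he => ?_
      exact hr.ne (hT.eq_of_ceil_eq hx hy he).1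
  · rw [List.pairwise_filter, List.pairwise_iff_getElem]
    intro j j' h1 h2 hj hpx hpy
    have hx : entry? T k (k + j) = some (T.getD k [])[j] :=
      entry?_eq_some.2 ⟨Nat.le_add_right _ _, by simp⟩
    have hy : entry? T k (k + j') = some (T.getD k [])[j'] :=
      entry?_eq_some.2 ⟨Nat.le_add_right _ _, by simp⟩
    rw [Bool.not_eq_true'] at hpx hpy
    refine ⟨⟨k, k + j, (T.getD k [])[j].primed⟩, ⟨k, k + j', (T.getD k [])[j'].primed⟩, hx, hy,
      Or.inr ⟨?_, Or.inr ⟨?_, ?_⟩⟩⟩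
    · simp only [Cell.block, hpx, hpy, Bool.false_eq_true, if_false]
    · rw [hpx, hpy]
    · refine (hT.ceil_le_of_row hx hy (by omega)).lt_of_ne fun he => ?_
      have := (hT.eq_of_ceil_eq hx hy he).2
      omega
  · have hpx := (List.mem_filter.1 hx).2
    have hpy := (List.mem_filter.1 hy).2
    obtain ⟨a, ha, hap, hak⟩ := mem_wordBlock.1 (List.mem_append_left _ hx)
    obtain ⟨b, hb, hbp, hbk⟩ := mem_wordBlock.1 (List.mem_append_right _ hy)
    rw [Bool.not_eq_true'] at hpy
    exact ⟨a, b, ha, hb, Or.inr ⟨hbk.trans hak.symm, Or.inl ⟨hap.trans hpx, hbp.trans hpy⟩⟩⟩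

theorem IsStd.pairwise_word {T : STab} (hT : IsStd T) :
    (((List.range (numCols T)).reverse).flatMap (wordBlock T)).Pairwise (WordLT T) := by
  refine List.pairwise_flatMap.2 ⟨fun k _ => hT.pairwise_wordBlock k, ?_⟩
  rw [List.pairwise_reverse]
  refine List.pairwise_lt_range.imp fun {k k'} hk x hx y hy => ?_
  obtain ⟨a, ha, -, hak⟩ := mem_wordBlock.1 hx
  obtain ⟨b, hb, -, hbk⟩ := mem_wordBlock.1 hy
  exact ⟨a, b, ha, hb, Or.inl (by omega)⟩

theorem idxOfZ_lt {R : Letter → Letter → Prop} {L : List Letter} (hL : L.Pairwise R) {u v : ℤ}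
    (hu : ∃ x ∈ L, x.ceil = u) (huv : u ≠ v)
    (hR : ∀ x y, x.ceil = v → y.ceil = u → ¬ R x y) :
    idxOfZ u (L.map Letter.ceil) < idxOfZ v (L.map Letter.ceil) := by
  induction L with
  | nil => simp at hu
  | cons z L ih =>
    rw [List.pairwise_cons] at hL
    simp only [List.map_cons, idxOfZ]
    by_cases hzu : z.ceil = u
    · rw [if_pos hzu, if_neg (hzu ▸ huv)]
      exact Nat.succ_pos _
    · obtain ⟨x, hx, rfl⟩ := hu
      have hx' : x ∈ L := (List.mem_cons.1 hx).resolve_left fun he => hzu (he ▸ rfl)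
      rw [if_neg hzu, if_neg fun hzv => hR z x hzv rfl (hL.1 x hx')]
      exact Nat.succ_lt_succ (ih hL.2 ⟨x, hx', rfl⟩)

theorem IsStd.cell_unique {T : STab} (hT : IsStd T) {v : ℤ} {a b : Cell} (ha : HasCell T v a)
    (hb : HasCell T v b) : a = b := by
  obtain ⟨ra, ca, pa⟩ := a
  obtain ⟨rb, cb, pb⟩ := b
  obtain ⟨rfl, rfl⟩ : ra = rb ∧ ca = cb := hT.eq_of_ceil_eq ha hb rfl
  simp only [HasCell] at ha hb
  rw [ha] at hb
  simp_all

theorem IsStd.idxOfZ_lt {T : STab} (hT : IsStd T) {u v : ℤ} {a b : Cell} (ha : HasCell T u a)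
    (hb : HasCell T v b) (huv : u ≠ v)
    (hab : ¬ (a.block < b.block ∨ a.block = b.block ∧
      (b.primed = true ∧ a.primed = false ∨ b.primed = a.primed ∧ v < u))) :
    idxOfZ u (shword T) < idxOfZ v (shword T) := by
  rw [shword_eq]
  refine _root_.idxOfZ_lt hT.pairwise_word ⟨⟨u, a.primed⟩, ?_, rfl⟩ huv ?_
  · simp only [List.mem_flatMap, List.mem_reverse, List.mem_range]
    refine ⟨a.block, ?_, mem_wordBlock.2 ⟨a, ha, rfl, rfl⟩⟩
    have h1 := (entry?_eq_some.1 ha).1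
    have h2 := (exists_entry?_iff.1 (hT.shifted.exists_below_le ⟨_, ha⟩ (Nat.zero_le _))).2
    have h3 : a.block ≤ a.col := by
      unfold Cell.block
      split_ifs
      · exact le_rfl
      · exact h1
    exact h3.trans_lt h2
  · rintro x y rfl rfl ⟨b', a', hb', ha', h⟩
    rw [hT.cell_unique ha' ha, hT.cell_unique hb' hb] at h
    exact hab h

theorem IsStd.idxOfZ_lt_iff {T : STab} (hT : IsStd T) {u v : ℤ} {a b : Cell} (ha : HasCell T u a)
    (hb : HasCell T v b) (huv : u < v) :
    (idxOfZ u (shword T) < idxOfZ v (shword T) ↔ a.Before b) ∧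
      (idxOfZ v (shword T) < idxOfZ u (shword T) ↔ ¬ a.Before b) := by
  by_cases h : a.Before b
  · have := hT.idxOfZ_lt ha hb huv.ne (by
      unfold Cell.Before at h
      rcases ha' : a.primed <;> rcases hb' : b.primed <;> simp [ha', hb'] at h ⊢ <;> omega)
    exact ⟨iff_of_true this h, iff_of_false this.asymm (not_not.2 h)⟩
  · have := hT.idxOfZ_lt hb ha huv.ne' (by
      unfold Cell.Before at h
      rcases ha' : a.primed <;> rcases hb' : b.primed <;> simp [ha', hb'] at h ⊢ <;> omega)
    exact ⟨iff_of_false this.asymm h, iff_of_true this h⟩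

/-! ## The dual equivalence operator as a relabelling -/

theorem IsStd.between {T : STab} (hT : IsStd T) {u v : ℤ} {a c : Cell} (ha : HasCell T u a)
    (hc : HasCell T v c) {r s : ℕ} (h1 : a.row ≤ r) (h2 : r ≤ c.row) (h3 : a.col ≤ s)
    (h4 : s ≤ c.col) (h5 : r ≤ s) : ∃ x, entry? T r s = some x ∧ u ≤ x.ceil ∧ x.ceil ≤ v := by
  obtain ⟨x, hx⟩ := hT.shifted.exists_dominated ⟨_, hc⟩ h2 h4 h5
  exact ⟨x, hx, hT.ceil_le ha hx h1 h3, hT.ceil_le hx hc h2 h4⟩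

theorem HasCell.row_le_col {T : STab} {v : ℤ} {a : Cell} (h : HasCell T v a) : a.row ≤ a.col :=
  (entry?_eq_some.1 h).1

theorem IsStd.adj_of_dominated {T : STab} (hT : IsStd T) {v : ℤ} {a b : Cell}
    (ha : HasCell T v a) (hb : HasCell T (v + 1) b) (hab : a.Dominated b) :
    b.row = a.row ∧ b.col = a.col + 1 ∨ b.row = a.row + 1 ∧ b.col = a.col := by
  have hla := ha.row_le_col
  have hlb := hb.row_le_col
  have hne : ¬ b.Dominated a := fun h => by
    have := hT.ceil_le hb ha h.1 h.2
    simp only at this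
    omega
  have key : ∀ r s, a.row ≤ r → r ≤ b.row → a.col ≤ s → s ≤ b.col → r ≤ s →
      r = a.row ∧ s = a.col ∨ r = b.row ∧ s = b.col := by
    intro r s h1 h2 h3 h4 h5
    obtain ⟨x, hx, h6, h7⟩ := hT.between ha hb h1 h2 h3 h4 h5
    rcases (by omega : x.ceil = v ∨ x.ceil = v + 1) with h | h
    · exact Or.inl (hT.eq_of_ceil_eq hx ha h)
    · exact Or.inr (hT.eq_of_ceil_eq hx hb h)
  have k1 := key a.row (a.col + 1)
  have k2 := key (a.row + 1) a.col
  have k3 := key a.row b.col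
  unfold Cell.Dominated at hab hne
  omega

theorem IsStd.consecutive {T : STab} (hT : IsStd T) {i : ℤ} {a b c : Cell}
    (ha : HasCell T i a) (hb : HasCell T (i + 1) b) (hc : HasCell T (i + 2) c) :
    Consecutive a b c := by
  have hlt : ∀ {u v : ℤ} {x y : Cell}, HasCell T u x → HasCell T v y → u < v →
      ¬ y.Dominated x := fun hx hy huv h => by
    have := hT.ceil_le hy hx h.1 h.2
    simp only at this
    omega
  have hca := hlt ha hc (by omega)
  have hla := ha.row_le_col
  have hlc := hc.row_le_col
  refine ⟨hla, hb.row_le_col, hlc, hlt ha hb (by omega), hlt hb hc (by omega), hca,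
    hT.adj_of_dominated ha hb, hT.adj_of_dominated hb (by rwa [add_assoc]), fun hac => ?_⟩
  have key : ∀ r s, a.row ≤ r → r ≤ c.row → a.col ≤ s → s ≤ c.col → r ≤ s →
      r = a.row ∧ s = a.col ∨ r = b.row ∧ s = b.col ∨ r = c.row ∧ s = c.col := by
    intro r s h1 h2 h3 h4 h5
    obtain ⟨x, hx, h6, h7⟩ := hT.between ha hc h1 h2 h3 h4 h5
    rcases (by omega : x.ceil = i ∨ x.ceil = i + 1 ∨ x.ceil = i + 2) with h | h | h
    · exact Or.inl (hT.eq_of_ceil_eq hx ha h)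
    · exact Or.inr (Or.inl (hT.eq_of_ceil_eq hx hb h))
    · exact Or.inr (Or.inr (hT.eq_of_ceil_eq hx hc h))
  obtain ⟨h1, h2⟩ := hac
  have hne : ¬ (c.row ≤ a.row ∧ c.col ≤ a.col) := hca
  clear hlt hca
  rcases h1.eq_or_lt with h1 | h1 <;> rcases h2.eq_or_lt with h2 | h2
  · omega
  · have k1 := key a.row (a.col + 1) le_rfl h1.le (by omega) h2 (by omega)
    have k2 := key a.row (a.col + 2) le_rfl h1.le (by omega)
    omega
  · have k1 := key (a.row + 1) a.col (by omega) h1 le_rfl h2.le (by omega)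
    have k2 := key (a.row + 2) a.col (by omega)
    omega
  · obtain ⟨hb1, hb2⟩ : a.row = b.row ∧ a.col + 1 = b.col := by
      have := key a.row (a.col + 1) le_rfl h1.le (by omega) h2 (by omega)
      omega
    have hd : a.row = a.col := by
      by_contra hn
      have := key (a.row + 1) a.col (by omega) h1 le_rfl h2.le (by omega)
      omega
    have hcc : c.col = a.col + 1 := by
      by_contra hn
      have := key a.row (a.col + 2) le_rfl h1.le (by omega) (by omega) (by omega)
      omega
    omega

/-- The map on letters realizing an effect on the values `i`, `i + 1` and `i + 2`. -/
def Effect.letterMap (i : ℤ) : Effect → Letter → Letter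
  | .swap01 => swapAt i (i + 1)
  | .swap12 => swapAt (i + 1) (i + 2)
  | .toggle t0 t1 t2 => fun x => ⟨x.ceil, xor x.primed
      (if x.ceil = i then t0 else if x.ceil = i + 1 then t1 else
        if x.ceil = i + 2 then t2 else false)⟩

theorem swapAt_swapAt (u v : ℤ) (x : Letter) : swapAt u v (swapAt u v x) = x := by
  simp [swapAt]

theorem Effect.letterMap_letterMap (i : ℤ) (e : Effect) (x : Letter) :
    e.letterMap i (e.letterMap i x) = x := by
  cases e with
  | swap01 => exact swapAt_swapAt _ _ _
  | swap12 => exact swapAt_swapAt _ _ _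
  | toggle t0 t1 t2 => simp [letterMap]

theorem Effect.letterMap_of_ne {i : ℤ} (e : Effect) {x : Letter} (h0 : x.ceil ≠ i)
    (h1 : x.ceil ≠ i + 1) (h2 : x.ceil ≠ i + 2) : e.letterMap i x = x := by
  cases e with
  | swap01 => simp [letterMap, swapAt, Equiv.swap_apply_of_ne_of_ne h0 h1]
  | swap12 => simp [letterMap, swapAt, Equiv.swap_apply_of_ne_of_ne h1 h2]
  | toggle t0 t1 t2 => simp [letterMap, h0, h1, h2]

theorem flipAt_eq (v : ℤ) (x : Letter) :
    flipAt v x = ⟨x.ceil, xor x.primed (decide (x.ceil = v))⟩ := by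
  unfold flipAt
  split_ifs with h <;> simp [h]

theorem Effect.letterMap_toggle (i : ℤ) (t0 t1 t2 : Bool) (x : Letter) :
    (Effect.toggle t0 t1 t2).letterMap i x = ⟨x.ceil, xor x.primed
      (xor (t0 && decide (x.ceil = i)) (xor (t1 && decide (x.ceil = i + 1))
        (t2 && decide (x.ceil = i + 2))))⟩ := by
  obtain ⟨v, p⟩ := x
  simp only [letterMap, Letter.mk.injEq, true_and]
  congr 1
  split_ifs with h0 h1 h2
  · subst h0
    simp
  · subst h1
    simp
  · subst h2
    simp
  · simp [h0, h1, h2]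

theorem IsStd.boxOf_of_hasCell {T : STab} (hT : IsStd T) {v : ℤ} {a : Cell}
    (h : HasCell T v a) : boxOf T v = some (a.row, a.col) :=
  hT.boxOf_eq h

theorem IsStd.diagBox?_of_hasCell {T : STab} (hT : IsStd T) {v : ℤ} {a : Cell}
    (h : HasCell T v a) : diagBox? T v = if a.OnDiag then some a.row else none := by
  simp [diagBox?, hT.boxOf_of_hasCell h, Cell.OnDiag]

theorem IsStd.togglePos_of_hasCell {T : STab} (hT : IsStd T) {v : ℤ} {a : Cell}
    (h : HasCell T v a) : togglePos T a.row a.col = tabMap (flipAt v) T :=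
  hT.togglePos_eq h

theorem HasCell.flipAt_of_ne {T : STab} {u v : ℤ} {a : Cell} (h : HasCell T u a) (huv : u ≠ v) :
    HasCell (tabMap (flipAt v) T) u a := by
  unfold HasCell at h ⊢
  rw [entry?_tabMap, h]
  simp [flipAt, huv]

theorem IsStd.switchDiag_eq {T : STab} (hT : IsStd T) {u v w : ℤ} {a b : Cell}
    (ha : HasCell T u a) (hb : HasCell T v b) (hda : a.OnDiag) (hdb : b.OnDiag)
    (huv : u ≠ v) (huw : u ≠ w) (hvw : v ≠ w) :
    switchDiag T (tabMap (flipAt w) T) u v =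
      if a.primed ≠ b.primed then tabMap (flipAt v) (tabMap (flipAt u) (tabMap (flipAt w) T))
      else tabMap (flipAt w) T := by
  have hU := hT.isStd_flipAt w
  have hra : diagBox? T u = some a.row := by rw [hT.diagBox?_of_hasCell ha, if_pos hda]
  have hrb : diagBox? T v = some b.row := by rw [hT.diagBox?_of_hasCell hb, if_pos hdb]
  have hUa := ha.flipAt_of_ne huw
  have hUb := hb.flipAt_of_ne hvw
  have h1 := hU.togglePos_of_hasCell hUa
  have h2 := (hU.isStd_flipAt u).togglePos_of_hasCell (hUb.flipAt_of_ne huv.symm)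
  unfold HasCell at hUa hUb
  simp only [Cell.OnDiag] at hda hdb
  rw [← hda] at hUa h1
  rw [← hdb] at hUb h2
  simp only [switchDiag, hra, hrb, switchAt, hUa, hUb, h1, h2, ne_eq, ite_not]

theorem IsStd.sOp_of_apart {T : STab} (hT : IsStd T) {i : ℤ} {a b : Cell}
    (ha : HasCell T i a) (hb : HasCell T (i + 1) b) (hab : a.Apart b) :
    sOp i T = tabMap (swapAt i (i + 1)) T := by
  rw [← hT.setEntryG_setEntryG ha hb (by omega)]
  unfold HasCell at ha hb
  simp only [sOp, hT.boxOf_of_hasCell ha, hT.boxOf_of_hasCell hb, ha, hb]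
  exact if_pos hab

theorem IsStd.sOp_of_not_onDiag {T : STab} (hT : IsStd T) {i : ℤ} {a b : Cell}
    (ha : HasCell T i a) (hb : HasCell T (i + 1) b) (hab : ¬ a.Apart b) (hda : ¬ a.OnDiag)
    (hdb : ¬ b.OnDiag) :
    sOp i T = tabMap (flipAt (i + 1)) (tabMap (flipAt i) T) := by
  rw [← (hT.isStd_flipAt i).togglePos_of_hasCell (hb.flipAt_of_ne (by omega)),
    ← hT.togglePos_of_hasCell ha]
  simp only [sOp, hT.boxOf_of_hasCell ha, hT.boxOf_of_hasCell hb]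
  exact (if_neg hab).trans (if_pos ⟨hda, hdb⟩)

theorem IsStd.sOp_of_onDiag_left {T : STab} (hT : IsStd T) {i : ℤ} {a b c : Cell}
    (ha : HasCell T i a) (hb : HasCell T (i + 1) b) (hc : HasCell T (i + 2) c)
    (hab : ¬ a.Apart b) (hda : a.OnDiag) (hdb : ¬ b.OnDiag) :
    sOp i T = if c.OnDiag ∧ a.primed ≠ c.primed then
        tabMap (flipAt (i + 2)) (tabMap (flipAt i) (tabMap (flipAt (i + 1)) T))
      else tabMap (flipAt (i + 1)) T := by
  have hn : i + 2 ≤ (T.flatten.length : ℤ) := (hT.ceil_bounds hc).2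
  simp only [sOp, hT.boxOf_of_hasCell ha, hT.boxOf_of_hasCell hb]
  refine (if_neg hab).trans ((if_neg fun h => h.1 hda).trans ?_)
  rw [if_pos (show a.row = a.col from hda), hT.togglePos_of_hasCell hb,
    if_neg (c := 1 ≤ i - 1 ∧ _) fun h => by simp [hT.diagBox?_of_hasCell hb, hdb] at h]
  by_cases hdc : c.OnDiag
  · rw [if_pos ⟨hn, by simp [hT.diagBox?_of_hasCell ha, hda],
      by simp [hT.diagBox?_of_hasCell hc, hdc]⟩,
      hT.switchDiag_eq ha hc hda hdc (by omega) (by omega) (by omega)]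
    simp [hdc]
  · rw [if_neg fun h => by simp [hT.diagBox?_of_hasCell hc, hdc] at h, if_neg fun h => hdc h.1]

theorem IsStd.sOp_of_onDiag_right {T : STab} (hT : IsStd T) {i : ℤ} {a b c : Cell}
    (ha : HasCell T i a) (hb : HasCell T (i + 1) b) (hc : HasCell T (i + 2) c)
    (hbc : ¬ b.Apart c) (hdb : ¬ b.OnDiag) (hdc : c.OnDiag) :
    sOp (i + 1) T = if a.OnDiag ∧ a.primed ≠ c.primed then
        tabMap (flipAt (i + 2)) (tabMap (flipAt i) (tabMap (flipAt (i + 1)) T))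
      else tabMap (flipAt (i + 1)) T := by
  have hn : 1 ≤ i := (hT.ceil_bounds ha).1
  have e1 : i + 1 + 1 = i + 2 := by ring
  simp only [sOp, e1, add_sub_cancel_right, hT.boxOf_of_hasCell hb, hT.boxOf_of_hasCell hc]
  refine (if_neg hbc).trans ((if_neg fun h => h.2 hdc).trans ?_)
  rw [if_neg (show ¬ b.row = b.col from hdb), hT.togglePos_of_hasCell hb,
    if_neg (c := i + 1 + 2 ≤ _ ∧ _) fun h => by simp [hT.diagBox?_of_hasCell hb, hdb] at h]
  by_cases hda : a.OnDiag
  · rw [if_pos ⟨hn, by simp [hT.diagBox?_of_hasCell ha, hda],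
      by simp [hT.diagBox?_of_hasCell hc, hdc]⟩,
      hT.switchDiag_eq ha hc hda hdc (by omega) (by omega) (by omega)]
    simp [hda]
  · rw [if_neg fun h => by simp [hT.diagBox?_of_hasCell ha, hda] at h, if_neg fun h => hda h.1]

theorem IsStd.dOp_eq {T : STab} (hT : IsStd T) {i : ℤ} {a b c : Cell}
    (ha : HasCell T i a) (hb : HasCell T (i + 1) b) (hc : HasCell T (i + 2) c) :
    dOp i T = tabMap ((effect a b c).letterMap i) T := by
  have h1 : 1 ≤ i := (hT.ceil_bounds ha).1
  have hn : i + 2 ≤ (T.flatten.length : ℤ) := (hT.ceil_bounds hc).2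
  have hcon := hT.consecutive ha hb hc
  have hab := hT.idxOfZ_lt_iff ha hb (by omega)
  have hac := hT.idxOfZ_lt_iff ha hc (by omega)
  have hbc := hT.idxOfZ_lt_iff hb hc (by omega)
  have htop : btwn (idxOfZ i (shword T)) (idxOfZ (i + 2) (shword T)) (idxOfZ (i + 1) (shword T)) ↔
      TopBetween a b c := by
    rw [btwn, TopBetween, hac.1, hac.2, hbc.1, hbc.2]
    by_cases a.Before c <;> by_cases b.Before c <;> simp [*]
  have hbot : btwn (idxOfZ (i + 1) (shword T)) (idxOfZ i (shword T)) (idxOfZ (i + 2) (shword T)) ↔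
      BotBetween a b c := by
    rw [btwn, BotBetween, hab.1, hab.2, hac.1, hac.2]
    by_cases a.Before b <;> by_cases a.Before c <;> simp [*]
  have e1 : i + 1 + 1 = i + 2 := by ring
  have toggle_eq : ∀ {f : Letter → Letter} {t0 t1 t2 : Bool},
      (∀ x, f x = (Effect.toggle t0 t1 t2).letterMap i x) →
      tabMap f T = tabMap ((Effect.toggle t0 t1 t2).letterMap i) T :=
    fun h => congrArg (tabMap · T) (funext h)
  simp only [dOp, htop, hbot]
  rw [if_neg (not_not.2 ⟨by omega, hn⟩), if_neg (by omega), if_neg (by omega)]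
  unfold effect
  by_cases ht : TopBetween a b c
  · rw [if_pos ht, if_pos ht]
    by_cases hA : a.Apart b
    · rw [if_pos hA, hT.sOp_of_apart ha hb hA]
      rfl
    have hdb := hcon.not_onDiag_of_topBetween ht hA
    rw [if_neg hA]
    by_cases hda : a.OnDiag
    · rw [if_pos hda, hT.sOp_of_onDiag_left ha hb hc hA hda hdb]
      split_ifs
      · rw [tabMap_tabMap, tabMap_tabMap]
        refine toggle_eq fun x => ?_
        simp only [Effect.letterMap_toggle, Function.comp, flipAt_eq, Bool.xor_assoc]
        simp [Bool.xor_left_comm]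
      · refine toggle_eq fun x => ?_
        simp [Effect.letterMap_toggle, flipAt_eq]
    · rw [if_neg hda, hT.sOp_of_not_onDiag ha hb hA hda hdb, tabMap_tabMap]
      refine toggle_eq fun x => ?_
      simp [Effect.letterMap_toggle, flipAt_eq]
  rw [if_neg ht, if_neg ht]
  by_cases hB : BotBetween a b c
  · rw [if_pos hB, if_pos hB]
    have hc' : HasCell T (i + 1 + 1) c := by rwa [e1]
    by_cases hA : b.Apart c
    · rw [if_pos hA, hT.sOp_of_apart hb hc' hA, e1]
      rfl
    have hdb := hcon.not_onDiag_of_botBetween hB hA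
    rw [if_neg hA]
    by_cases hdc : c.OnDiag
    · rw [if_pos hdc, hT.sOp_of_onDiag_right ha hb hc hA hdb hdc]
      split_ifs
      · rw [tabMap_tabMap, tabMap_tabMap]
        refine toggle_eq fun x => ?_
        simp only [Effect.letterMap_toggle, Function.comp, flipAt_eq, Bool.xor_assoc]
        simp [Bool.xor_left_comm]
      · refine toggle_eq fun x => ?_
        simp [Effect.letterMap_toggle, flipAt_eq]
    · rw [if_neg hdc, hT.sOp_of_not_onDiag hb hc' hA hdb hdc, tabMap_tabMap, e1]
      refine toggle_eq fun x => ?_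
      simp [Effect.letterMap_toggle, flipAt_eq]
  · rw [if_neg hB, if_neg hB]
    conv_lhs => rw [← tabMap_id T]
    refine toggle_eq fun x => ?_
    simp [Effect.letterMap]

theorem IsStd.isStd_swapAt {T : STab} (hT : IsStd T) {v : ℤ} {a b : Cell}
    (ha : HasCell T v a) (hb : HasCell T (v + 1) b) (hab : a.Apart b) :
    IsStd (tabMap (swapAt v (v + 1)) T) := by
  refine hT.isStd_tabMap (s := Equiv.swap v (v + 1)) (fun _ => rfl)
    (fun _ => Equiv.swap_apply_self _ _ _) (fun w h1 h2 => ?_) ?_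
  · have h3 : 1 ≤ v := (hT.ceil_bounds ha).1
    have h4 : v + 1 ≤ (T.flatten.length : ℤ) := (hT.ceil_bounds hb).2
    rw [Equiv.swap_apply_def]
    split_ifs <;> omega
  · intro r c r' c' x y hx hy hrc hlt
    have : ¬ (x.ceil = v ∧ y.ceil = v + 1) := by
      rintro ⟨h1, h2⟩
      obtain ⟨rfl, rfl⟩ := hT.eq_of_ceil_eq hx ha h1
      obtain ⟨rfl, rfl⟩ := hT.eq_of_ceil_eq hy hb h2
      exact hrc.elim hab.1 hab.2
    rw [Equiv.swap_apply_def, Equiv.swap_apply_def]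
    split_ifs <;> omega

theorem HasCell.tabMap {T : STab} {v w : ℤ} {a : Cell} {p : Bool} (h : HasCell T v a)
    {g : Letter → Letter} (hg : g ⟨v, a.primed⟩ = ⟨w, p⟩) :
    HasCell (tabMap g T) w ⟨a.row, a.col, p⟩ := by
  unfold HasCell at h ⊢
  rw [entry?_tabMap, h, Option.map_some, hg]

theorem IsStd.isStd_dOp {T : STab} (hT : IsStd T) {i : ℤ} {a b c : Cell}
    (ha : HasCell T i a) (hb : HasCell T (i + 1) b) (hc : HasCell T (i + 2) c) :
    IsStd (dOp i T) := by
  have e1 : i + 1 + 1 = i + 2 := by ring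
  rw [hT.dOp_eq ha hb hc]
  cases he : effect a b c with
  | swap01 =>
    refine hT.isStd_swapAt ha hb ?_
    unfold effect at he
    split_ifs at he
    assumption
  | swap12 =>
    rw [Effect.letterMap, ← e1]
    refine hT.isStd_swapAt hb (by rwa [e1]) ?_
    unfold effect at he
    split_ifs at he
    assumption
  | toggle t0 t1 t2 =>
    exact hT.isStd_tabMap (s := id) (fun _ => rfl) (fun _ => rfl) (fun _ h1 h2 => ⟨h1, h2⟩)
      (fun _ _ _ _ _ _ _ _ _ h => h)

theorem Effect.hasCell_tabMap {T : STab} {i : ℤ} {a b c : Cell} (e : Effect)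
    (ha : HasCell T i a) (hb : HasCell T (i + 1) b) (hc : HasCell T (i + 2) c) :
    HasCell (tabMap (e.letterMap i) T) i (e.act a b c).1 ∧
      HasCell (tabMap (e.letterMap i) T) (i + 1) (e.act a b c).2.1 ∧
      HasCell (tabMap (e.letterMap i) T) (i + 2) (e.act a b c).2.2 := by
  cases e with
  | swap01 =>
    refine ⟨hb.tabMap ?_, ha.tabMap ?_, hc.tabMap ?_⟩ <;>
      simp [letterMap, swapAt, Equiv.swap_apply_def]
  | swap12 =>
    refine ⟨ha.tabMap ?_, hc.tabMap ?_, hb.tabMap ?_⟩ <;>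
      simp [letterMap, swapAt, Equiv.swap_apply_def]
  | toggle t0 t1 t2 =>
    refine ⟨ha.tabMap ?_, hb.tabMap ?_, hc.tabMap ?_⟩ <;> simp [letterMap]

theorem IsStd.dOp_dOp {T : STab} (hT : IsStd T) {i : ℤ} {a b c : Cell}
    (ha : HasCell T i a) (hb : HasCell T (i + 1) b) (hc : HasCell T (i + 2) c) :
    dOp i (dOp i T) = T := by
  have hU := hT.isStd_dOp ha hb hc
  have h := hT.dOp_eq ha hb hc
  obtain ⟨ha', hb', hc'⟩ := (effect a b c).hasCell_tabMap ha hb hc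
  rw [← h] at ha' hb' hc'
  rw [hU.dOp_eq ha' hb' hc',
    (hT.consecutive ha hb hc).effect_act (hU.consecutive ha' hb' hc') rfl, h, tabMap_tabMap]
  conv_rhs => rw [← tabMap_id T]
  exact congrArg (tabMap · T) (funext fun x => Effect.letterMap_letterMap i _ x)

theorem IsStd.exists_perm {T : STab} (hT : IsStd T) {i : ℤ} {a b c : Cell}
    (ha : HasCell T i a) (hb : HasCell T (i + 1) b) (hc : HasCell T (i + 2) c) :
    ∃ R : List Letter,
      T.flatten.Perm (⟨i, a.primed⟩ :: ⟨i + 1, b.primed⟩ :: ⟨i + 2, c.primed⟩ :: R) ∧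
      ∀ x ∈ R, x.ceil ≠ i ∧ x.ceil ≠ i + 1 ∧ x.ceil ≠ i + 2 := by
  have hmem : ∀ {v : ℤ} {d : Cell}, HasCell T v d → (⟨v, d.primed⟩ : Letter) ∈ T.flatten :=
    fun hd => mem_flatten_iff_entry?.2 ⟨_, _, hd⟩
  obtain ⟨R, hR⟩ : ∃ R : List Letter,
      T.flatten.Perm (⟨i, a.primed⟩ :: ⟨i + 1, b.primed⟩ :: ⟨i + 2, c.primed⟩ :: R) := by
    refine ⟨((T.flatten.erase ⟨i, a.primed⟩).erase ⟨i + 1, b.primed⟩).erase ⟨i + 2, c.primed⟩, ?_⟩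
    refine (List.perm_cons_erase (hmem ha)).trans (List.Perm.cons _ ?_)
    refine (List.perm_cons_erase ?_).trans (List.Perm.cons _ (List.perm_cons_erase ?_))
    · exact (List.mem_erase_of_ne (by simp)).2 (hmem hb)
    · exact (List.mem_erase_of_ne (by simp)).2 ((List.mem_erase_of_ne (by simp)).2 (hmem hc))
  refine ⟨R, hR, fun x hx => ?_⟩
  have hnd := (hR.map Letter.ceil).nodup_iff.1 hT.nodup
  have hx' := List.mem_map_of_mem (f := Letter.ceil) hx
  simp only [List.map_cons, List.nodup_cons, List.mem_cons, not_or] at hnd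
  exact ⟨fun h => hnd.1.2.2 (h ▸ hx'), fun h => hnd.2.1.2 (h ▸ hx'), fun h => hnd.2.2.1 (h ▸ hx')⟩

theorem IsStd.exists_numPrimes_eq {T : STab} (hT : IsStd T) {i : ℤ} {a b c : Cell}
    (ha : HasCell T i a) (hb : HasCell T (i + 1) b) (hc : HasCell T (i + 2) c) :
    ∃ k, numPrimes T = primeCount a b c + k ∧ ∀ t0 t1 t2,
      numPrimes (tabMap ((Effect.toggle t0 t1 t2).letterMap i) T) =
        primeCount (a.flip t0) (b.flip t1) (c.flip t2) + k := by
  obtain ⟨R, hR, hne⟩ := hT.exists_perm ha hb hc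
  have key : ∀ u v w : ℤ, ∀ p q r : Bool,
      ((⟨u, p⟩ :: ⟨v, q⟩ :: ⟨w, r⟩ :: R : List Letter).countP fun x => x.primed) =
        p.toNat + q.toNat + r.toNat + R.countP fun x => x.primed := by
    intro u v w p q r
    cases p <;> cases q <;> cases r <;> simp <;> omega
  refine ⟨R.countP fun x => x.primed, ?_, fun t0 t1 t2 => ?_⟩
  · rw [numPrimes, hR.countP_eq, key]
    rfl
  · have hmap : R.map ((Effect.toggle t0 t1 t2).letterMap i) = R :=
      (List.map_congr_left (g := id) fun x hx =>
        Effect.letterMap_of_ne _ (hne x hx).1 (hne x hx).2.1 (hne x hx).2.2).trans (List.map_id R)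
    rw [numPrimes, flatten_tabMap, (hR.map _).countP_eq, List.map_cons, List.map_cons,
      List.map_cons, hmap]
    refine (key _ _ _ _ _ _).trans ?_
    simp [primeCount, Cell.flip]

theorem numPrimes_tabMap_swapAt (u v : ℤ) (T : STab) :
    numPrimes (tabMap (swapAt u v) T) = numPrimes T := by
  rw [numPrimes, flatten_tabMap, List.countP_map]
  rfl

theorem map_primed_entry?_tabMap_swapAt (u v : ℤ) (T : STab) (r c : ℕ) :
    (entry? (tabMap (swapAt u v) T) r c).map Letter.primed =
      (entry? T r c).map Letter.primed := by
  rw [entry?_tabMap, Option.map_map]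
  rfl

theorem IsStd.numPrimes_dOp_of_not_onDiag {T : STab} (hT : IsStd T) {i : ℤ} {a b c : Cell}
    (ha : HasCell T i a) (hb : HasCell T (i + 1) b) (hc : HasCell T (i + 2) c)
    (hd : ¬ (a.OnDiag ∧ c.OnDiag)) :
    numPrimes (dOp i T) = numPrimes T ∧
      ∀ r, (entry? (dOp i T) r r).map Letter.primed = (entry? T r r).map Letter.primed := by
  rw [hT.dOp_eq ha hb hc]
  cases he : effect a b c with
  | swap01 => exact ⟨numPrimes_tabMap_swapAt _ _ _,
      fun r => map_primed_entry?_tabMap_swapAt _ _ _ _ _⟩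
  | swap12 => exact ⟨numPrimes_tabMap_swapAt _ _ _,
      fun r => map_primed_entry?_tabMap_swapAt _ _ _ _ _⟩
  | toggle t0 t1 t2 =>
    obtain ⟨hp, h0, h1, h2⟩ :=
      (hT.consecutive ha hb hc).effect_toggle_of_not_onDiag hd he
    obtain ⟨k, hk, hk'⟩ := hT.exists_numPrimes_eq ha hb hc
    refine ⟨by rw [hk, hk', hp], fun r => ?_⟩
    rw [entry?_tabMap]
    cases hx : entry? T r r with
    | none => rfl
    | some x =>
      have onDiag : ∀ {v : ℤ} {d : Cell}, HasCell T v d → x.ceil = v → d.OnDiag := fun hd h => by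
        obtain ⟨h3, h4⟩ := hT.eq_of_ceil_eq hx hd h
        exact h3.symm.trans h4
      simp only [Option.map_some, Effect.letterMap, Option.some.injEq]
      split_ifs with h3 h4 h5
      · rw [h0 (onDiag ha h3), Bool.xor_false]
      · rw [h1 (onDiag hb h4), Bool.xor_false]
      · rw [h2 (onDiag hc h5), Bool.xor_false]
      · exact Bool.xor_false _

theorem IsStd.numPrimes_dOp_of_onDiag {T : STab} (hT : IsStd T) {i : ℤ} {a b c : Cell}
    (ha : HasCell T i a) (hb : HasCell T (i + 1) b) (hc : HasCell T (i + 2) c)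
    (hda : a.OnDiag) (hdc : c.OnDiag) :
    numPrimes T = numPrimes (dOp i T) + 1 ∨ numPrimes T + 1 = numPrimes (dOp i T) := by
  obtain ⟨k, hk, hk'⟩ := hT.exists_numPrimes_eq ha hb hc
  rw [hT.dOp_eq ha hb hc, (hT.consecutive ha hb hc).effect_eq_toggle_of_onDiag hda hdc, hk, hk']
  cases h1 : a.primed <;> cases h2 : b.primed <;> cases h3 : c.primed <;>
    simp [primeCount, Cell.flip, h1, h2, h3] <;> omega

theorem IsStd.entry?_dOp {T : STab} (hT : IsStd T) {i : ℤ} {a b c : Cell}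
    (ha : HasCell T i a) (hb : HasCell T (i + 1) b) (hc : HasCell T (i + 2) c) {r s : ℕ}
    (h0 : boxOf T i ≠ some (r, s)) (h1 : boxOf T (i + 1) ≠ some (r, s))
    (h2 : boxOf T (i + 2) ≠ some (r, s)) : entry? (dOp i T) r s = entry? T r s := by
  rw [hT.dOp_eq ha hb hc, entry?_tabMap]
  cases hx : entry? T r s with
  | none => rfl
  | some x =>
    have hbox := hT.boxOf_eq hx
    exact congrArg some (Effect.letterMap_of_ne _ (fun h => h0 (h ▸ hbox)) (fun h => h1 (h ▸ hbox))
      (fun h => h2 (h ▸ hbox)))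

theorem IsStd.exists_hasCell {T : STab} (hT : IsStd T) {v : ℤ} (h1 : 1 ≤ v)
    (h2 : v ≤ T.flatten.length) : ∃ a, HasCell T v a := by
  obtain ⟨r, c, p, h⟩ := hT.exists_entry? h1 h2
  exact ⟨⟨r, c, p⟩, h⟩

theorem IsStd.exists_boxOf_eq_diag_iff {T : STab} (hT : IsStd T) {v : ℤ} {a : Cell}
    (h : HasCell T v a) : (∃ r, boxOf T v = some (r, r)) ↔ a.OnDiag := by
  simp only [hT.boxOf_of_hasCell h, Option.some.injEq, Prod.mk.injEq, Cell.OnDiag]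
  exact ⟨fun ⟨_, h1, h2⟩ => h1.trans h2.symm, fun h => ⟨_, rfl, h.symm⟩⟩

/-- Proposition 3.37: properties of the dual equivalence operator
`𝔡_i` on a standard shifted tableau with `n` boxes, for `i ∈ [n-1]`. -/
theorem stmt15 (T : STab) (hT : IsShifted T) (hstd : IsStandard T) (i : ℤ)
    (hi : 1 ≤ i) (hi' : i ≤ (T.flatten.length : ℤ) - 1) :
    (dOp i (dOp i T) = T ∧
      ∀ r c : ℕ, boxOf T i ≠ some (r, c) → boxOf T (i + 1) ≠ some (r, c) →
        boxOf T (i + 2) ≠ some (r, c) → entry? (dOp i T) r c = entry? T r c) ∧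
    (¬((∃ r, boxOf T i = some (r, r)) ∧ (∃ r, boxOf T (i + 2) = some (r, r))) →
      numPrimes (dOp i T) = numPrimes T ∧
      ∀ r, (entry? (dOp i T) r r).map Letter.primed =
        (entry? T r r).map Letter.primed) ∧
    ((∃ r, boxOf T i = some (r, r)) ∧ (∃ r, boxOf T (i + 2) = some (r, r)) →
      numPrimes T = numPrimes (dOp i T) + 1 ∨ numPrimes T + 1 = numPrimes (dOp i T)) := by
  have hS := isStd_of_isStandard hT hstd
  by_cases hn : i + 2 ≤ (T.flatten.length : ℤ)
  · obtain ⟨a, ha⟩ := hS.exists_hasCell hi (by omega)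
    obtain ⟨b, hb⟩ := hS.exists_hasCell (v := i + 1) (by omega) (by omega)
    obtain ⟨c, hc⟩ := hS.exists_hasCell (v := i + 2) (by omega) hn
    rw [hS.exists_boxOf_eq_diag_iff ha, hS.exists_boxOf_eq_diag_iff hc]
    exact ⟨⟨hS.dOp_dOp ha hb hc, fun r s h0 h1 h2 => hS.entry?_dOp ha hb hc h0 h1 h2⟩,
      hS.numPrimes_dOp_of_not_onDiag ha hb hc,
      fun hd => hS.numPrimes_dOp_of_onDiag ha hb hc hd.1 hd.2⟩
  · have hd : dOp i T = T := if_pos fun h => hn h.2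
    have hbox : boxOf T (i + 2) = none := boxOf_eq_none_of_lt hS (not_le.1 hn)
    simp only [hd, hbox]
    simp
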